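/- Let n ≥ 1, N := 2^n, let A, C ∈ ℂ^{N×N}, and let P denote the orthogonal projection of ℂ^{N×N} onto su_loc(2^n) with respect to the real inner product ⟨g,h⟩ = Re tr(g†h). Let U : [0,∞) → ℂ^{N×N} be a differentiable curve with U(0) ∈ SU_loc(2^n) satisfying the gradient system U'(t) = P([C†, U(t) A U(t)†]) · U(t) for all t ≥ 0. Then U(t) ∈ SU_loc(2^n) for all t ≥ 0, the function t ↦ Re tr(C† U(t) A U(t)†) is nondecreasing, and U(t) converges as t → +∞ to a matrix U∞ ∈ SU_loc(2^n) satisfying the critical point condition P([C†, U∞ A U∞†]) = 0. -/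

import Mathlib

open Matrix Filter Topology

attribute [local instance] Matrix.normedAddCommGroup Matrix.normedSpace

/-- `localOp n k M` is the Kronecker product `1₂ ⊗ … ⊗ M ⊗ … ⊗ 1₂` (with `M` in the `k`-th
factor), realised as a matrix indexed by `Fin n → Fin 2 ≃ Fin (2^n)`. -/
noncomputable def localOp (n : ℕ) (k : Fin n) (M : Matrix (Fin 2) (Fin 2) ℂ) :
    Matrix (Fin n → Fin 2) (Fin n → Fin 2) ℂ :=
  Matrix.of fun i j =>
    M (i k) (j k) * ∏ l ∈ Finset.univ.erase k, (if i l = j l then 1 else 0)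

/-- The Lie algebra `su_loc(2^n)` of local unitary operations on `n` qubits: sums
`Σ_k 1₂ ⊗ … ⊗ Ω_k ⊗ … ⊗ 1₂` with each `Ω_k ∈ su(2)` (traceless skew-Hermitian). -/
def suLoc (n : ℕ) : Set (Matrix (Fin n → Fin 2) (Fin n → Fin 2) ℂ) :=
  {g | ∃ Ω : Fin n → Matrix (Fin 2) (Fin 2) ℂ,
    (∀ k, (Ω k)ᴴ = -(Ω k) ∧ (Ω k).trace = 0) ∧ g = ∑ k, localOp n k (Ω k)}

/-- The group `SU_loc(2^n)` of local unitaries: `n`-fold Kronecker products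
`K₁ ⊗ … ⊗ K_n` of `SU(2)` matrices, realised as matrices indexed by `Fin n → Fin 2`. -/
def SUloc (n : ℕ) : Set (Matrix (Fin n → Fin 2) (Fin n → Fin 2) ℂ) :=
  {U | ∃ K : Fin n → Matrix (Fin 2) (Fin 2) ℂ,
    (∀ k, K k ∈ Matrix.specialUnitaryGroup (Fin 2) ℂ) ∧
    U = Matrix.of fun i j => ∏ k, K k (i k) (j k)}

theorem dvr_key {k V : Type*} [Field k] [CharZero k] [CommRing V] [IsDomain V]
    [IsDiscreteValuationRing V] [Algebra k V]
    [Algebra.IsAlgebraic k (IsLocalRing.ResidueField V)]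
    (d : Derivation k V V) (hd : d ≠ 0) {f : V} (hf : f ∈ IsLocalRing.maximalIdeal V)
    (hf0 : f ≠ 0) {w : V} (hw : w ∈ Ideal.span (Set.range d)) : d f ≠ f * w := by
  obtain ⟨t, ht⟩ := IsDiscreteValuationRing.exists_irreducible V
  have htm : IsLocalRing.maximalIdeal V = Ideal.span {t} := ht.maximalIdeal_eq
  have hex : ∃ n, ∃ z, ¬ t ^ (n + 1) ∣ d z := by
    by_contra! h
    apply hd
    ext z
    by_contra hz
    obtain ⟨n, u, hu⟩ := IsDiscreteValuationRing.eq_unit_mul_pow_irreducible hz ht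
    have := h n z
    rw [hu, pow_succ, mul_comm (u : V)] at this
    exact ht.not_isUnit (isUnit_of_dvd_unit
      ((mul_dvd_mul_iff_left (pow_ne_zero n ht.ne_zero)).1 this) u.isUnit)
  classical
  obtain ⟨z, hz⟩ := Nat.find_spec hex
  have hmin := fun m => Nat.find_min hex (m := m)
  set n := Nat.find hex with hn
  have hall : ∀ y, t ^ n ∣ d y := by
    intro y
    rcases Nat.eq_zero_or_pos n with h0 | h0
    · simp [h0]
    · have := hmin (n - 1) (by omega)
      push Not at this
      have h := this y
      rwa [Nat.sub_add_cancel h0] at h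
  have hdt : ¬ t ^ (n + 1) ∣ d t := by
    intro hdt
    have hlt : ∀ y, t ^ (n + 1) ∣ d (t * y) := by
      intro y
      rw [Derivation.leibniz, smul_eq_mul, smul_eq_mul, pow_succ']
      refine dvd_add (mul_dvd_mul_left _ (hall y)) ?_
      rw [← pow_succ']
      exact hdt.mul_left _
    set zb := IsLocalRing.residue V z
    have halg : IsIntegral k zb := (Algebra.IsAlgebraic.isAlgebraic zb).isIntegral
    set p := minpoly k zb
    have hsep : p.Separable := (minpoly.irreducible halg).separable
    have hmk : ∀ q : Polynomial k, IsLocalRing.residue V (Polynomial.aeval z q) =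
        Polynomial.aeval zb q := by
      intro q
      exact (Polynomial.aeval_algebraMap_apply (IsLocalRing.ResidueField V) z q).symm
    have h1 : Polynomial.aeval z p ∈ IsLocalRing.maximalIdeal V := by
      rw [← IsLocalRing.residue_eq_zero_iff, hmk, minpoly.aeval]
    have h2 : IsUnit (Polynomial.aeval z (Polynomial.derivative p)) := by
      rw [← IsLocalRing.residue_ne_zero_iff_isUnit, hmk]
      exact hsep.aeval_derivative_ne_zero (minpoly.aeval _ _)
    rw [htm, Ideal.mem_span_singleton] at h1
    obtain ⟨y, hy⟩ := h1
    have h3 : d (Polynomial.aeval z p) = Polynomial.aeval z (Polynomial.derivative p) * d z := by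
      rw [Derivation.map_aeval, smul_eq_mul]
    apply hz
    rw [← h2.dvd_mul_left, ← h3, hy]
    exact hlt y
  intro hdf
  obtain ⟨m, u, hu⟩ := IsDiscreteValuationRing.eq_unit_mul_pow_irreducible hf0 ht
  have hm : m ≠ 0 := by
    rintro rfl
    rw [pow_zero, mul_one] at hu
    exact (IsLocalRing.mem_maximalIdeal f).1 hf (hu ▸ u.isUnit)
  obtain ⟨m, rfl⟩ := Nat.exists_eq_succ_of_ne_zero hm
  have hwn : t ^ n ∣ w := by
    rw [← Ideal.mem_span_singleton]
    refine Ideal.span_le.2 ?_ hw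
    rintro _ ⟨y, rfl⟩
    exact Ideal.mem_span_singleton.2 (hall y)
  have hmu : IsUnit ((m.succ : ℕ) : V) := by
    have : ((m.succ : ℕ) : V) = algebraMap k V (m.succ : ℕ) := by simp
    rw [this]
    exact (IsUnit.mk0 _ (Nat.cast_ne_zero.2 (Nat.succ_ne_zero m))).map _
  apply hdt
  have e1 : d f = t ^ m * ((u : V) * (m.succ : ℕ) * d t + t * d u) := by
    rw [hu, Derivation.leibniz, Derivation.leibniz_pow]
    simp only [smul_eq_mul, nsmul_eq_mul, Nat.succ_sub_one, Nat.succ_eq_add_one]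
    ring
  have e2 : (u : V) * (m.succ : ℕ) * d t + t * d u = t * ((u : V) * w) := by
    apply mul_left_cancel₀ (pow_ne_zero m ht.ne_zero)
    rw [← e1, hdf, hu, Nat.succ_eq_add_one]; ring
  have e3 : t ^ (n + 1) ∣ (u : V) * (m.succ : ℕ) * d t := by
    rw [eq_sub_of_add_eq e2, pow_succ']
    exact dvd_sub (mul_dvd_mul_left _ (hwn.mul_left _)) (mul_dvd_mul_left _ (hall _))
  exact ((u.isUnit.mul hmu).dvd_mul_left).1 e3

theorem Derivation.exists_codRestrict {k V L : Type*} [Field k] [CommRing V] [Field L]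
    [Algebra k V] [Algebra V L] [Algebra k L] [IsScalarTower k V L]
    (hinj : Function.Injective (algebraMap V L))
    (D : Derivation k V L) (h : ∀ z, ∃ y, algebraMap V L y = D z) :
    ∃ d : Derivation k V V, ∀ z, algebraMap V L (d z) = D z := by
  choose φ hφ using h
  refine ⟨Derivation.mk' { toFun := φ, map_add' := ?_, map_smul' := ?_ } ?_, hφ⟩
  · intro x y; apply hinj; simp [hφ]
  · intro c x; apply hinj
    rw [hφ, map_smul, RingHom.id_apply, Algebra.smul_def, Algebra.smul_def, map_mul, hφ,
      ← IsScalarTower.algebraMap_apply]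
  · intro x y; apply hinj
    simp [hφ, Algebra.smul_def]

theorem dedekind_key {k O L : Type*} [Field k] [CharZero k] [CommRing O]
    [IsDedekindDomain O] [Algebra k O] [Field L] [Algebra O L] [Algebra k L]
    [IsScalarTower k O L] [IsFractionRing O L] (P : Ideal O) [P.IsPrime] (hP : P ≠ ⊥)
    [Algebra.IsAlgebraic k (O ⧸ P)] (D : Derivation k L L) (hD : D ≠ 0)
    {b : O} (hb : b ≠ 0) (hbD : ∀ z : O, ∃ y : O, algebraMap O L y =
      algebraMap O L b * D (algebraMap O L z))
    {f : O} (hf : f ∈ P) (hf0 : f ≠ 0) {ι : Type*} [Fintype ι] (g x : ι → O) :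
    D (algebraMap O L f) ≠
      algebraMap O L f * ∑ i, algebraMap O L (g i) * D (algebraMap O L (x i)) := by
  let V := Localization.AtPrime P
  have : IsDiscreteValuationRing V :=
    IsLocalization.AtPrime.isDiscreteValuationRing_of_dedekind_domain O hP V
  have hle : P.primeCompl ≤ nonZeroDivisors O := P.primeCompl_le_nonZeroDivisors
  have hunit : ∀ s : P.primeCompl, IsUnit (algebraMap O L s) := fun s =>
    IsUnit.mk0 _ (by
      rw [Ne, IsFractionRing.to_map_eq_zero_iff]
      exact nonZeroDivisors.ne_zero (hle s.2))
  let : Algebra V L := (IsLocalization.lift (M := P.primeCompl) hunit).toAlgebra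
  have : IsScalarTower O V L := IsScalarTower.of_algebraMap_eq fun z =>
    (IsLocalization.lift_eq (M := P.primeCompl) (S := V) hunit z).symm
  have : IsFractionRing V L :=
    IsFractionRing.isFractionRing_of_isDomain_of_isLocalization P.primeCompl V L
  have : IsScalarTower k V L := IsScalarTower.of_algebraMap_eq fun z => by
    rw [IsScalarTower.algebraMap_apply k O V, ← IsScalarTower.algebraMap_apply O V L,
      ← IsScalarTower.algebraMap_apply k O L]
  have hinj : Function.Injective (algebraMap V L) := IsFractionRing.injective V L
  have : Algebra.IsAlgebraic k (IsLocalRing.ResidueField V) := by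
    refine ⟨fun y => ?_⟩
    obtain ⟨a, s, -, rfl⟩ := IsFractionRing.div_surjective (O ⧸ P) (K := P.ResidueField) y
    have key : ∀ z : O ⧸ P, IsAlgebraic k (algebraMap (O ⧸ P) P.ResidueField z) := fun z =>
      (Algebra.IsAlgebraic.isAlgebraic (R := k) z).algebraMap
    rw [div_eq_mul_inv]
    exact (key a).mul (key s).inv
  let D1 : Derivation k V L := (algebraMap O L b) • (D.compAlgebraMap V)
  have hD1 : ∀ z, D1 z = algebraMap O L b * D (algebraMap V L z) := fun z => rfl
  have hOV : ∀ z : O, algebraMap O L z = algebraMap V L (algebraMap O V z) := fun z =>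
    IsScalarTower.algebraMap_apply O V L z
  have hrange : ∀ z, ∃ y, algebraMap V L y = D1 z := by
    intro z
    obtain ⟨⟨a, s⟩, rfl⟩ := IsLocalization.mk'_surjective P.primeCompl z
    obtain ⟨p, hp⟩ := hbD a
    obtain ⟨q, hq⟩ := hbD s
    have hs0 : algebraMap O L s ≠ 0 := (hunit s).ne_zero
    have hz : algebraMap V L (IsLocalization.mk' V a s) = algebraMap O L a / algebraMap O L s := by
      rw [eq_div_iff hs0, hOV s, ← map_mul, IsLocalization.mk'_spec, ← hOV]
    refine ⟨IsLocalization.mk' V (s * p - a * q) (s * s), ?_⟩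
    have hz2 : algebraMap V L (IsLocalization.mk' V (s * p - a * q) (s * s)) =
        algebraMap O L (s * p - a * q) / algebraMap O L (s * s : P.primeCompl) := by
      rw [eq_div_iff (hunit _).ne_zero, hOV (s * s : P.primeCompl), ← map_mul,
        IsLocalization.mk'_spec, ← hOV]
    rw [hz2, hD1, hz, Derivation.leibniz_div]
    simp only [map_sub, map_mul, hp, hq, Submonoid.coe_mul, smul_eq_mul]
    field_simp
  obtain ⟨d, hd⟩ := Derivation.exists_codRestrict hinj D1 hrange
  have hbL : algebraMap O L b ≠ 0 := by rwa [Ne, IsFractionRing.to_map_eq_zero_iff]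
  have hd0 : d ≠ 0 := by
    rintro rfl
    apply hD
    have h0 : ∀ z : V, D (algebraMap V L z) = 0 := fun z => by
      have := hd z
      rw [hD1] at this
      simpa [hbL] using this.symm
    ext z
    obtain ⟨a, s, hs, rfl⟩ := IsFractionRing.div_surjective V z
    simp [Derivation.leibniz_div, h0]
  intro heq
  refine dvr_key d hd0 (f := algebraMap O V f) ?_ ?_
    (w := ∑ i, algebraMap O V (g i) * d (algebraMap O V (x i))) ?_ ?_
  · exact (IsLocalization.AtPrime.to_map_mem_maximal_iff V P f).2 hf
  · rw [Ne, ← hinj.eq_iff, ← hOV, map_zero, IsFractionRing.to_map_eq_zero_iff]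
    exact hf0
  · exact Ideal.sum_mem _ fun i _ => Ideal.mul_mem_left _ _ (Ideal.subset_span ⟨_, rfl⟩)
  · apply hinj
    simp only [hd, hD1, map_mul, map_sum, ← hOV, heq, Finset.mul_sum]
    exact Finset.sum_congr rfl fun i _ => by ring

theorem isAlgebraic_of_isIntegral_polynomial {k Q : Type*} [Field k] [CommRing Q]
    [Algebra k Q] [IsDomain Q] (φ : Polynomial k →ₐ[k] Q) (hφ : φ.toRingHom.IsIntegral)
    {q : Polynomial k} (hq : q ≠ 0) (hφq : φ q = 0) : Algebra.IsAlgebraic k Q := by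
  let r : AdjoinRoot q →+* Q := Ideal.Quotient.lift (Ideal.span {q}) φ.toRingHom fun a ha => by
    obtain ⟨c, rfl⟩ := Ideal.mem_span_singleton.1 ha
    simp [hφq]
  have hr : r.comp (AdjoinRoot.mk q) = φ.toRingHom := by
    ext <;> rfl
  have h1 : r.IsIntegral := by
    refine RingHom.IsIntegral.tower_top (AdjoinRoot.mk q) r ?_
    rwa [hr]
  have h2 : (AdjoinRoot.of q).IsIntegral := by
    have := (AdjoinRoot.powerBasis hq).finite
    exact (Algebra.IsIntegral.of_finite k (AdjoinRoot q)).isIntegral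
  have h3 : algebraMap k Q = r.comp (AdjoinRoot.of q) := by
    have : (AdjoinRoot.of q) = (AdjoinRoot.mk q).comp Polynomial.C := rfl
    rw [this, ← RingHom.comp_assoc, hr]
    ext c
    exact (φ.commutes c).symm
  have h4 : (algebraMap k Q).IsIntegral := h3 ▸ h2.trans _ _ h1
  exact ⟨fun z => IsIntegral.isAlgebraic (h4 z)⟩

theorem exists_derivation_of_finite_extension {k K L : Type*} [Field k] [CharZero k] [Field K]
    [Field L] [Algebra (Polynomial k) K] [IsFractionRing (Polynomial k) K] [Algebra K L]
    [FiniteDimensional K L] [Algebra (Polynomial k) L] [IsScalarTower (Polynomial k) K L]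
    [Algebra k L] [IsScalarTower k (Polynomial k) L] [Algebra.IsSeparable K L] :
    ∃ D : Derivation k L L, ∀ q : Polynomial k, D (algebraMap _ L q) =
      algebraMap _ L (Polynomial.derivative q) := by
  have : Algebra.FormallyEtale (Polynomial k) K :=
    Algebra.FormallyEtale.of_isLocalization (nonZeroDivisors (Polynomial k))
  have : Algebra.FormallyEtale K L := Algebra.FormallyEtale.of_isSeparable K L
  have : Algebra.FormallyEtale (Polynomial k) L := Algebra.FormallyEtale.comp _ K L
  let δ : Derivation k (Polynomial k) L := Polynomial.mkDerivation k (1 : L)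
  let e := KaehlerDifferential.tensorKaehlerEquivOfFormallyEtale k (Polynomial k) L
  refine ⟨((δ.liftKaehlerDifferential.liftBaseChange L).comp e.symm.toLinearMap).compDer
    (KaehlerDifferential.D k L), fun q => ?_⟩
  have h1 : e.symm (KaehlerDifferential.D k L (algebraMap _ L q)) = _ :=
    KaehlerDifferential.tensorKaehlerEquivOfFormallyEtale_symm_D_algebraMap k (Polynomial k) L q
  change (δ.liftKaehlerDifferential.liftBaseChange L)
    (e.symm (KaehlerDifferential.D k L (algebraMap _ L q))) = _
  rw [h1]
  simp [δ, Polynomial.mkDerivation_apply, Algebra.smul_def]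

theorem curve_key_aux {k O L : Type*} [Field k] [CharZero k] [CommRing O] [IsDedekindDomain O]
    [Field L] [Algebra (Polynomial k) L] [Algebra k L] [IsScalarTower k (Polynomial k) L]
    [Algebra (Polynomial k) O] [Algebra O L] [Algebra k O] [IsScalarTower k (Polynomial k) O]
    [IsScalarTower (Polynomial k) O L] [IsScalarTower k O L] [IsFractionRing O L]
    [Module.Finite (Polynomial k) O]
    {D : Derivation k L L} (hDq : ∀ q : Polynomial k, D (algebraMap _ L q) =
      algebraMap _ L (Polynomial.derivative q))
    {f : O} (hf0 : f ≠ 0) (hnu : f ∈ nonunits O) {ι : Type*} [Fintype ι] (g x : ι → O) :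
    D (algebraMap O L f) ≠
      algebraMap O L f * ∑ i, algebraMap O L (g i) * D (algebraMap O L (x i)) := by
  obtain ⟨P, hPmax, hfP⟩ := exists_max_ideal_of_mem_nonunits hnu
  have hP : P ≠ ⊥ := by rintro rfl; exact hf0 hfP
  have hcomap : P.comap (algebraMap (Polynomial k) O) ≠ ⊥ := by
    exact Ideal.IsIntegral.comap_ne_bot _ hP
  obtain ⟨q, hq, hq0⟩ := Submodule.exists_mem_ne_zero_of_ne_bot hcomap
  have : Algebra.IsAlgebraic k (O ⧸ P) := by
    let π : O →ₐ[k] O ⧸ P := Ideal.Quotient.mkₐ k P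
    refine isAlgebraic_of_isIntegral_polynomial (Q := O ⧸ P)
      (π.comp (IsScalarTower.toAlgHom k (Polynomial k) O)) ?_ hq0
      ((Ideal.Quotient.eq_zero_iff_mem (I := P)).2 hq)
    have h1 : (algebraMap (Polynomial k) O).IsIntegral := fun z =>
      Algebra.IsIntegral.isIntegral (R := Polynomial k) z
    exact h1.trans _ (Ideal.Quotient.mk P)
      (RingHom.isIntegral_of_surjective _ Ideal.Quotient.mk_surjective)
  obtain ⟨S, hS⟩ := ‹Module.Finite (Polynomial k) O›
  classical
  obtain ⟨⟨b, hb⟩, hbS⟩ := IsLocalization.exist_integer_multiples_of_finset (nonZeroDivisors O)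
    (S.image fun s => D (algebraMap O L s))
  have hD : D ≠ 0 := by
    rintro rfl
    have := hDq Polynomial.X
    simp at this
  refine dedekind_key P hP D hD (b := b) (nonZeroDivisors.ne_zero hb) ?_ (f := f) hfP hf0
    g x
  intro z
  have hz : z ∈ Submodule.span (Polynomial k) (S : Set O) := hS ▸ Submodule.mem_top
  induction hz using Submodule.span_induction with
  | mem s hs =>
    obtain ⟨y, hy⟩ := hbS _ (Finset.mem_image_of_mem _ hs)
    exact ⟨y, by rw [hy, Algebra.smul_def]⟩
  | zero => exact ⟨0, by simp⟩
  | add u v _ _ hu hv =>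
    obtain ⟨y, hy⟩ := hu
    obtain ⟨w, hw⟩ := hv
    exact ⟨y + w, by rw [map_add, map_add, map_add, hy, hw, mul_add]⟩
  | smul p u _ hu =>
    obtain ⟨y, hy⟩ := hu
    refine ⟨p • y + b * (Polynomial.derivative p • u), ?_⟩
    simp only [Algebra.smul_def, map_add, map_mul, hy, Derivation.leibniz,
      ← IsScalarTower.algebraMap_apply, hDq]
    ring

theorem curve_key {k K L : Type*} [Field k] [CharZero k] [Field K]
    [Field L] [Algebra (Polynomial k) K] [IsFractionRing (Polynomial k) K] [Algebra K L]
    [FiniteDimensional K L] [Algebra (Polynomial k) L] [IsScalarTower (Polynomial k) K L]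
    [Algebra k L] [IsScalarTower k (Polynomial k) L] [Algebra.IsSeparable K L]
    {f : L} (hf : IsIntegral (Polynomial k) f) (hf0 : f ≠ 0)
    (hfi : ¬ IsIntegral (Polynomial k) f⁻¹) :
    ∃ D : Derivation k L L, ∀ (ι : Type) [Fintype ι] (g x : ι → L),
      (∀ i, IsIntegral (Polynomial k) (g i)) → (∀ i, IsIntegral (Polynomial k) (x i)) →
      D f ≠ f * ∑ i, g i * D (x i) := by
  obtain ⟨D, hDq⟩ := exists_derivation_of_finite_extension (k := k) (K := K) (L := L)
  refine ⟨D, fun ι _ g x hg hx => ?_⟩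
  let O := integralClosure (Polynomial k) L
  have : IsDedekindDomain O := integralClosure.isDedekindDomain _ K L
  have : IsFractionRing O L :=
    IsIntegralClosure.isFractionRing_of_finite_extension (Polynomial k) K L O
  have : IsScalarTower k O L := IsScalarTower.of_algebraMap_eq fun z => rfl
  have : Module.Finite (Polynomial k) O :=
    IsIntegralClosure.finite (Polynomial k) K L O
  let f' : O := ⟨f, hf⟩
  have hf'0 : f' ≠ 0 := fun h => hf0 (congrArg Subtype.val h)
  have hnu : f' ∈ nonunits O := by
    rintro ⟨u, hu⟩
    apply hfi
    have h1 : f * ((u⁻¹ : Oˣ) : O) = 1 := by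
      have : f' * ((u⁻¹ : Oˣ) : O) = 1 := by rw [← hu]; simp
      exact congrArg Subtype.val this
    rw [← eq_inv_of_mul_eq_one_right h1]
    exact ((u⁻¹ : Oˣ) : O).2
  exact curve_key_aux hDq hf'0 hnu (fun i => ⟨g i, hg i⟩) (fun i => ⟨x i, hx i⟩)

section
open scoped nonZeroDivisors

attribute [local instance] Polynomial.algebra FractionRing.liftAlgebra

theorem exists_C_mul_inv_isIntegral {R B L : Type*} [CommRing R] [IsDomain R] [CharZero R]
    [CommRing B] [IsDomain B] [Algebra (Polynomial R) B] [FaithfulSMul (Polynomial R) B]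
    [Module.Finite (Polynomial R) B] [Field L] [Algebra B L] [IsFractionRing B L]
    [Algebra (Polynomial R) L] [IsScalarTower (Polynomial R) B L] [Algebra R L]
    [IsScalarTower R (Polynomial R) L]
    {f : B} (hf0 : f ≠ 0) {ι : Type} [Fintype ι] (g x : ι → B)
    (h : ∀ D : Derivation R L L, D (algebraMap B L f) =
      algebraMap B L f * ∑ i, algebraMap B L (g i) * D (algebraMap B L (x i))) :
    ∃ c : R, c ≠ 0 ∧ IsIntegral (Polynomial R)
      (algebraMap (Polynomial R) L (Polynomial.C c) * (algebraMap B L f)⁻¹) := by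
  have : FaithfulSMul (Polynomial R) L := FaithfulSMul.trans (Polynomial R) B L
  let K₀ := FractionRing R
  let K := FractionRing (Polynomial R)
  have hloc : IsLocalization (R⁰.map Polynomial.C) (Polynomial K₀) := Polynomial.isLocalization R⁰ K₀
  have : CharZero K₀ := charZero_of_injective_algebraMap (IsFractionRing.injective R K₀)
  have hu : ∀ y : R⁰.map (Polynomial.C : R →+* Polynomial R),
      IsUnit (algebraMap (Polynomial R) K y) := by
    rintro ⟨_, c, hc, rfl⟩
    have hc0 : c ≠ 0 := nonZeroDivisors.ne_zero hc
    exact (IsUnit.mk0 _ (by simpa using hc0))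
  let φ : Polynomial K₀ →+* K := IsLocalization.lift (M := R⁰.map Polynomial.C) hu
  let _ : Algebra (Polynomial K₀) K := φ.toAlgebra
  have : IsScalarTower (Polynomial R) (Polynomial K₀) K :=
    IsScalarTower.of_algebraMap_eq fun z => (IsLocalization.lift_eq hu z).symm
  have : IsFractionRing (Polynomial K₀) K :=
    IsFractionRing.isFractionRing_of_isDomain_of_isLocalization (R⁰.map Polynomial.C) _ _
  have : FiniteDimensional K L := Module.Finite.of_isLocalization (Polynomial R) B (Polynomial R)⁰
  let _ : Algebra (Polynomial K₀) L := ((algebraMap K L).comp φ).toAlgebra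
  have : IsScalarTower (Polynomial K₀) K L := IsScalarTower.of_algebraMap_eq fun z => rfl
  have : IsScalarTower (Polynomial R) (Polynomial K₀) L := IsScalarTower.of_algebraMap_eq fun z => by
    rw [IsScalarTower.algebraMap_apply (Polynomial K₀) K L,
      ← IsScalarTower.algebraMap_apply (Polynomial R) (Polynomial K₀) K,
      ← IsScalarTower.algebraMap_apply (Polynomial R) K L]
  let _ : Algebra K₀ L := ((algebraMap (Polynomial K₀) L).comp Polynomial.C).toAlgebra
  have : IsScalarTower K₀ (Polynomial K₀) L := IsScalarTower.of_algebraMap_eq fun z => rfl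
  have : IsScalarTower R K₀ L := IsScalarTower.of_algebraMap_eq fun z => by
    rw [IsScalarTower.algebraMap_apply K₀ (Polynomial K₀) L,
      IsScalarTower.algebraMap_apply R (Polynomial R) L,
      IsScalarTower.algebraMap_apply (Polynomial R) (Polynomial K₀) L]
    congr 1
    simp [Polynomial.algebraMap_def]
  have : CharZero K := charZero_of_injective_algebraMap
    (IsFractionRing.injective (Polynomial K₀) K)
  have hint : ∀ b : B, IsIntegral (Polynomial K₀) (algebraMap B L b) := fun b =>
    ((Algebra.IsIntegral.isIntegral (R := Polynomial R) b).map
      (IsScalarTower.toAlgHom (Polynomial R) B L)).tower_top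
  have hinv : IsIntegral (Polynomial K₀) (algebraMap B L f)⁻¹ := by
    by_contra hni
    obtain ⟨D, hD⟩ := curve_key (k := K₀) (K := K) (hint f) (by simpa using hf0) hni
    exact hD ι _ _ (fun i => hint (g i)) (fun i => hint (x i)) (h (D.restrictScalars R))
  obtain ⟨⟨_, c, hc, rfl⟩, hm⟩ :=
    IsIntegral.exists_multiple_integral_of_isLocalization (R⁰.map Polynomial.C) _ hinv
  refine ⟨c, nonZeroDivisors.ne_zero hc, ?_⟩
  rwa [Submonoid.smul_def, Algebra.smul_def] at hm

end

theorem exists_norm_eq_coeff_zero_minpoly_pow (K : Type*) {L : Type*} [Field K] [Field L]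
    [Algebra K L] [FiniteDimensional K L] (y : L) :
    ∃ r, r ≠ 0 ∧ ∃ m : ℕ, Algebra.norm K y = ((-1) ^ m * (minpoly K y).coeff 0) ^ r := by
  have hy : IsIntegral K y := Algebra.IsIntegral.isIntegral _
  refine ⟨_, (Module.finrank_pos (R := IntermediateField.adjoin K {y}) (M := L)).ne',
    (IntermediateField.adjoin.powerBasis hy).dim, ?_⟩
  rw [Algebra.norm_eq_norm_adjoin, ← IntermediateField.adjoin.powerBasis_gen hy,
    Algebra.PowerBasis.norm_gen_eq_coeff_zero_minpoly, IntermediateField.adjoin.powerBasis_gen hy,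
    IntermediateField.minpoly_gen]

theorem isUnit_of_isUnit_coeff_zero {R B : Type*} [CommRing R] [CommRing B] [Algebra R B]
    {p : Polynomial R} {f : B} (hp : Polynomial.aeval f p = 0) (h : IsUnit (p.coeff 0)) :
    IsUnit f := by
  have h1 := congrArg (Polynomial.aeval f) (Polynomial.X_mul_divX_add p)
  simp only [map_add, map_mul, Polynomial.aeval_X, Polynomial.aeval_C, hp] at h1
  refine isUnit_of_mul_isUnit_left (y := - Polynomial.aeval f p.divX) ?_
  rw [mul_neg, neg_eq_of_add_eq_zero_right h1]
  exact h.map _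

theorem MvPolynomial.isUnit_of_forall_degreeOf_eq_zero {σ k : Type*} [Field k]
    {a : MvPolynomial σ k} (ha : a ≠ 0) (h : ∀ j, MvPolynomial.degreeOf j a = 0) : IsUnit a := by
  classical
  have h1 : a.totalDegree = 0 := by
    rw [MvPolynomial.totalDegree_eq_zero_iff]
    intro m hm x
    have := MvPolynomial.monomial_le_degreeOf x hm
    rw [h x] at this
    omega
  rw [MvPolynomial.totalDegree_eq_zero_iff_eq_C] at h1
  rw [h1]
  refine IsUnit.map _ (IsUnit.mk0 _ fun h2 => ha ?_)
  rw [h1, h2, map_zero]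

section

variable {σ k B L : Type*} [Field k] [CharZero k] [CommRing B] [IsDomain B]
  [Algebra (MvPolynomial σ k) B] [FaithfulSMul (MvPolynomial σ k) B]
  [Module.Finite (MvPolynomial σ k) B] [Field L] [Algebra B L] [IsFractionRing B L]
  [Algebra (MvPolynomial σ k) L] [IsScalarTower (MvPolynomial σ k) B L] [Algebra k L]
  [IsScalarTower k (MvPolynomial σ k) L]
  {f : B} {ι : Type} [Fintype ι] (g x : ι → B)

theorem exists_degreeOf_eq_zero_mul_inv_isIntegral (hf0 : f ≠ 0)
    (h : ∀ D : Derivation k L L, D (algebraMap B L f) =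
      algebraMap B L f * ∑ i, algebraMap B L (g i) * D (algebraMap B L (x i))) (j : σ) :
    ∃ c : MvPolynomial σ k, c ≠ 0 ∧ MvPolynomial.degreeOf j c = 0 ∧
      IsIntegral (MvPolynomial σ k) (algebraMap _ L c * (algebraMap B L f)⁻¹) := by
  classical
  let R := MvPolynomial {b // b ≠ j} k
  let e : MvPolynomial σ k ≃ₐ[k] Polynomial R :=
    (MvPolynomial.renameEquiv k (Equiv.optionSubtypeNe j).symm).trans
      (MvPolynomial.optionEquivLeft k {b // b ≠ j})
  let _ : Algebra (Polynomial R) B :=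
    ((algebraMap (MvPolynomial σ k) B).comp e.symm.toRingEquiv.toRingHom).toAlgebra
  let _ : Algebra (Polynomial R) L := ((algebraMap B L).comp (algebraMap (Polynomial R) B)).toAlgebra
  have : IsScalarTower (Polynomial R) B L := IsScalarTower.of_algebraMap_eq fun z => rfl
  let _ : Algebra R L := ((algebraMap (Polynomial R) L).comp Polynomial.C).toAlgebra
  have : IsScalarTower R (Polynomial R) L := IsScalarTower.of_algebraMap_eq fun z => rfl
  have : FaithfulSMul (Polynomial R) B := by
    rw [faithfulSMul_iff_algebraMap_injective]
    exact (FaithfulSMul.algebraMap_injective (MvPolynomial σ k) B).comp e.symm.injective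
  have : Module.Finite (Polynomial R) B := by
    have h1 : (algebraMap (MvPolynomial σ k) B).Finite := RingHom.finite_algebraMap.2 inferInstance
    exact RingHom.finite_algebraMap.1
      (h1.comp (RingHom.Finite.of_surjective _ e.symm.surjective))
  have hAL : ∀ z : Polynomial R, algebraMap (Polynomial R) L z = algebraMap _ L (e.symm z) :=
    fun z => (IsScalarTower.algebraMap_apply (MvPolynomial σ k) B L _).symm
  have : IsScalarTower k R L := IsScalarTower.of_algebraMap_eq fun z => by
    rw [IsScalarTower.algebraMap_apply R (Polynomial R) L, hAL,
      IsScalarTower.algebraMap_apply k (MvPolynomial σ k) L]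
    congr 1
    rw [AlgEquiv.eq_symm_apply, AlgEquiv.commutes]
    rfl
  obtain ⟨c, hc0, hc⟩ := exists_C_mul_inv_isIntegral (R := R) (L := L) hf0 g x
    (fun D => h (D.restrictScalars k))
  refine ⟨e.symm (Polynomial.C c), by simpa using hc0, ?_, ?_⟩
  · rw [MvPolynomial.degreeOf_eq_natDegree, ← MvPolynomial.renameEquiv_apply]
    change (e (e.symm (Polynomial.C c))).natDegree = 0
    rw [AlgEquiv.apply_symm_apply, Polynomial.natDegree_C]
  · rw [hAL] at hc
    refine RingHom.IsIntegralElem.of_comp (f := e.symm.toRingEquiv.toRingHom) ?_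
    have h1 : (algebraMap (MvPolynomial σ k) L).comp e.symm.toRingEquiv.toRingHom =
        algebraMap (Polynomial R) L := RingHom.ext fun z => (hAL z).symm
    rw [h1]
    exact hc

open scoped nonZeroDivisors in
attribute [local instance] FractionRing.liftAlgebra in
theorem isUnit_of_forall_derivation_eq_mul_of_finite [Finite σ] (hf0 : f ≠ 0)
    (h : ∀ D : Derivation k L L, D (algebraMap B L f) =
      algebraMap B L f * ∑ i, algebraMap B L (g i) * D (algebraMap B L (x i))) :
    IsUnit f := by
  let A := MvPolynomial σ k
  have : FaithfulSMul A L := FaithfulSMul.trans A B L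
  let K := FractionRing A
  have : FiniteDimensional K L := Module.Finite.of_isLocalization A B A⁰
  have hfint : IsIntegral A f := Algebra.IsIntegral.isIntegral f
  set p := minpoly A f
  have hpf : Polynomial.aeval f p = 0 := minpoly.aeval A f
  have hpK : minpoly K (algebraMap B L f) = p.map (algebraMap A K) :=
    minpoly.isIntegrallyClosed_eq_field_fractions K L hfint
  have hfL : algebraMap B L f ≠ 0 := by simpa using hf0
  have hnorm : ∃ r, r ≠ 0 ∧ ∃ m : ℕ, Algebra.norm K (algebraMap B L f) =
      algebraMap A K (((-1) ^ m * p.coeff 0) ^ r) := by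
    obtain ⟨r, hr, m, h1⟩ := exists_norm_eq_coeff_zero_minpoly_pow K (algebraMap B L f)
    refine ⟨r, hr, m, ?_⟩
    rw [h1, hpK]
    simp
  obtain ⟨r, hr, m, hnorm⟩ := hnorm
  have hp0 : p.coeff 0 ≠ 0 := by
    intro h0
    rw [h0, mul_zero, zero_pow hr, map_zero, Algebra.norm_eq_zero_iff] at hnorm
    exact hfL hnorm
  refine isUnit_of_isUnit_coeff_zero hpf
    (MvPolynomial.isUnit_of_forall_degreeOf_eq_zero hp0 fun j => ?_)
  obtain ⟨c, hc0, hcj, hc⟩ := exists_degreeOf_eq_zero_mul_inv_isIntegral (L := L) g x hf0 h j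
  obtain ⟨b, hb⟩ := IsIntegrallyClosed.isIntegral_iff.1 (Algebra.isIntegral_norm K hc)
  have h1 : c ^ Module.finrank K L = ((-1) ^ m * p.coeff 0) ^ r * b := by
    apply IsFractionRing.injective A K
    rw [map_mul, hb, ← hnorm, ← map_mul, mul_comm, inv_mul_cancel_right₀ hfL,
      IsScalarTower.algebraMap_apply A K L, Algebra.norm_algebraMap, map_pow]
  have h2 : p.coeff 0 ∣ c ^ Module.finrank K L := by
    rw [h1]
    exact ((Dvd.intro_left _ rfl).trans (dvd_pow_self _ hr)).mul_right _
  obtain ⟨d, hd⟩ := h2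
  have hd0 : d ≠ 0 := by
    rintro rfl
    rw [mul_zero] at hd
    exact hc0 (pow_eq_zero_iff Module.finrank_pos.ne' |>.1 hd)
  have h3 := congrArg (MvPolynomial.degreeOf j) hd
  rw [MvPolynomial.degreeOf_pow_eq _ _ _ hc0, hcj, mul_zero,
    MvPolynomial.degreeOf_mul_eq hp0 hd0] at h3
  omega

end

attribute [local instance] FractionRing.liftAlgebra in
theorem isUnit_of_forall_derivation_eq_mul {k B L : Type*} [Field k] [CharZero k]
    [CommRing B] [IsDomain B] [Algebra k B] [Algebra.FiniteType k B] [Field L] [Algebra B L]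
    [IsFractionRing B L] [Algebra k L] [IsScalarTower k B L] {f : B} (hf0 : f ≠ 0)
    {ι : Type} [Fintype ι] (g x : ι → B)
    (h : ∀ D : Derivation k L L, D (algebraMap B L f) =
      algebraMap B L f * ∑ i, algebraMap B L (g i) * D (algebraMap B L (x i))) :
    IsUnit f := by
  obtain ⟨s, φ, hφ, hfin⟩ := exists_finite_inj_algHom_of_fg k B
  let _ : Algebra (MvPolynomial (Fin s) k) B := φ.toRingHom.toAlgebra
  let _ : Algebra (MvPolynomial (Fin s) k) L := ((algebraMap B L).comp φ.toRingHom).toAlgebra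
  have : IsScalarTower (MvPolynomial (Fin s) k) B L := IsScalarTower.of_algebraMap_eq fun z => rfl
  have : FaithfulSMul (MvPolynomial (Fin s) k) B :=
    (faithfulSMul_iff_algebraMap_injective _ _).2 hφ
  have : Module.Finite (MvPolynomial (Fin s) k) B := hfin
  have : IsScalarTower k (MvPolynomial (Fin s) k) L := IsScalarTower.of_algebraMap_eq fun z => by
    rw [IsScalarTower.algebraMap_apply (MvPolynomial (Fin s) k) B L,
      IsScalarTower.algebraMap_apply k B L]
    congr 1
    exact (φ.commutes z).symm
  exact isUnit_of_forall_derivation_eq_mul_of_finite (σ := Fin s) g x hf0 h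

theorem MvPolynomial.derivation_algebraMap_eq_sum {σ k F : Type*} [Fintype σ] [CommRing k]
    [CommRing F] [Algebra k F] [Algebra (MvPolynomial σ k) F] [IsScalarTower k (MvPolynomial σ k) F]
    (D : Derivation k F F) (p : MvPolynomial σ k) :
    D (algebraMap (MvPolynomial σ k) F p) =
      ∑ i, algebraMap (MvPolynomial σ k) F (MvPolynomial.pderiv i p) * D (algebraMap (MvPolynomial σ k) F (MvPolynomial.X i)) := by
  classical
  induction p using MvPolynomial.induction_on with
  | C c =>
    have : algebraMap (MvPolynomial σ k) F (MvPolynomial.C c) = algebraMap k F c :=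
      (IsScalarTower.algebraMap_apply k (MvPolynomial σ k) F c).symm
    simp [this]
  | add p q hp hq => simp [hp, hq, add_mul, Finset.sum_add_distrib]
  | mul_X p j hp =>
    simp only [map_mul, Derivation.leibniz, hp, smul_eq_mul, map_add, add_mul,
      Finset.sum_add_distrib, MvPolynomial.pderiv_X]
    congr 1
    · rw [Finset.sum_eq_single j]
      · simp
      · intro b _ hb
        simp [hb.symm]
      · simp
    · rw [Finset.mul_sum]
      exact Finset.sum_congr rfl fun i _ => by ring

theorem MvPolynomial.exists_mul_aeval_logDeriv_eq_one {σ : Type} [Fintype σ] {k : Type*} [Field k]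
    [CharZero k] {F : Type*} [Field F] [Algebra (MvPolynomial σ k) F]
    [IsFractionRing (MvPolynomial σ k) F] [Algebra k F] [IsScalarTower k (MvPolynomial σ k) F]
    {p : MvPolynomial σ k} (hp : p ≠ 0) :
    ∃ Q : MvPolynomial (σ ⊕ σ) k, algebraMap (MvPolynomial σ k) F p * MvPolynomial.aeval
      (Sum.elim (fun i => algebraMap (MvPolynomial σ k) F (MvPolynomial.X i))
        (fun i => algebraMap (MvPolynomial σ k) F (MvPolynomial.pderiv i p) / algebraMap (MvPolynomial σ k) F p)) Q = 1 := by
  set v : σ ⊕ σ → F := Sum.elim (fun i => algebraMap (MvPolynomial σ k) F (MvPolynomial.X i))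
    (fun i => algebraMap (MvPolynomial σ k) F (MvPolynomial.pderiv i p) / algebraMap (MvPolynomial σ k) F p) with hv
  let B := Algebra.adjoin k (Set.range v)
  have hvB : ∀ s, v s ∈ B := fun s => Algebra.subset_adjoin ⟨s, rfl⟩
  have hfg : Algebra.FiniteType k B :=
    (Subalgebra.fg_iff_finiteType _).1 (by
      simpa using Subalgebra.fg_adjoin_finset (R := k) (Set.finite_range v).toFinset)
  have hA : ∀ a : MvPolynomial σ k, algebraMap (MvPolynomial σ k) F a ∈ B := by
    intro a
    induction a using MvPolynomial.induction_on with
    | C c =>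
      have : algebraMap (MvPolynomial σ k) F (MvPolynomial.C c) = algebraMap k F c :=
        (IsScalarTower.algebraMap_apply k (MvPolynomial σ k) F c).symm
      rw [this]
      exact B.algebraMap_mem c
    | add p q hp hq => rw [map_add]; exact B.add_mem hp hq
    | mul_X p j hp => rw [map_mul]; exact B.mul_mem hp (hvB (Sum.inl j))
  have hfrac : IsFractionRing B F := by
    refine IsFractionRing.of_field _ _ fun z => ?_
    obtain ⟨a, b, _, rfl⟩ := IsFractionRing.div_surjective (A := MvPolynomial σ k) z
    exact ⟨⟨_, hA a⟩, ⟨_, hA b⟩, rfl⟩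
  have hpF : algebraMap (MvPolynomial σ k) F p ≠ 0 := by simpa using hp
  have hunit : IsUnit (⟨_, hA p⟩ : B) := by
    refine isUnit_of_forall_derivation_eq_mul (k := k) (L := F)
      (fun h => hpF (congrArg Subtype.val h))
      (fun i : σ => ⟨_, hvB (Sum.inr i)⟩) (fun i : σ => ⟨_, hvB (Sum.inl i)⟩) fun D => ?_
    change D (algebraMap (MvPolynomial σ k) F p) = algebraMap (MvPolynomial σ k) F p * ∑ i, v (Sum.inr i) * D (v (Sum.inl i))
    rw [MvPolynomial.derivation_algebraMap_eq_sum, Finset.mul_sum]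
    refine Finset.sum_congr rfl fun i _ => ?_
    simp only [hv, Sum.elim_inr, Sum.elim_inl]
    field_simp
  obtain ⟨w, hw⟩ := hunit.exists_right_inv
  have hwB : (w : F) ∈ Algebra.adjoin k (Set.range v) := w.2
  rw [Algebra.adjoin_range_eq_range_aeval] at hwB
  obtain ⟨Q, hQ⟩ := hwB
  exact ⟨Q, (congrArg (_ * ·) hQ).trans (congrArg Subtype.val hw)⟩

theorem MvPolynomial.exists_eval_mul_eval_logDeriv_eq_one {σ : Type} [Fintype σ] {k : Type*}
    [Field k] [CharZero k] {p : MvPolynomial σ k} (hp : p ≠ 0) :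
    ∃ Q : MvPolynomial (σ ⊕ σ) k, ∀ q : σ → k, MvPolynomial.eval q p ≠ 0 →
      MvPolynomial.eval q p * MvPolynomial.eval
        (Sum.elim q fun i => MvPolynomial.eval q (MvPolynomial.pderiv i p) /
          MvPolynomial.eval q p) Q = 1 := by
  let A := MvPolynomial σ k
  let F := FractionRing A
  let S := Localization.Away p
  obtain ⟨Q, hQ⟩ := MvPolynomial.exists_mul_aeval_logDeriv_eq_one (F := F) hp
  refine ⟨Q, fun q hq => ?_⟩
  have hpF : algebraMap A F p ≠ 0 := by simpa using hp
  have hu : IsUnit (algebraMap A F p) := IsUnit.mk0 _ hpF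
  let φ : S →+* F := IsLocalization.Away.lift p hu
  let _ : Algebra S F := φ.toAlgebra
  have : IsScalarTower A S F :=
    IsScalarTower.of_algebraMap_eq fun z => (IsLocalization.Away.lift_eq p hu z).symm
  have : IsFractionRing S F :=
    IsFractionRing.isFractionRing_of_isDomain_of_isLocalization (Submonoid.powers p) _ _
  have hinj : Function.Injective (algebraMap S F) := IsFractionRing.injective S F
  have hqu : IsUnit (MvPolynomial.eval q p) := IsUnit.mk0 _ hq
  let ε : S →+* k := IsLocalization.Away.lift (g := MvPolynomial.eval q) p hqu
  have hε : ∀ a : A, ε (algebraMap A S a) = MvPolynomial.eval q a := fun a =>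
    IsLocalization.Away.lift_eq p hqu a
  let w : S := IsLocalization.Away.invSelf p
  have hw : algebraMap A S p * w = 1 := IsLocalization.Away.mul_invSelf p
  let v : σ ⊕ σ → S := Sum.elim (fun i => algebraMap A S (MvPolynomial.X i))
    (fun i => algebraMap A S (MvPolynomial.pderiv i p) * w)
  have hwF : algebraMap S F w = (algebraMap A F p)⁻¹ := by
    refine eq_inv_of_mul_eq_one_right ?_
    rw [IsScalarTower.algebraMap_apply A S F, ← map_mul, hw, map_one]
  have hwk : ε w = (MvPolynomial.eval q p)⁻¹ := by
    refine eq_inv_of_mul_eq_one_right ?_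
    rw [← hε p, ← map_mul, hw, map_one]
  have h1 : algebraMap A S p * MvPolynomial.eval₂ ((algebraMap A S).comp MvPolynomial.C) v Q = 1 := by
    apply hinj
    rw [map_mul, map_one, ← IsScalarTower.algebraMap_apply A S F, ← hQ, MvPolynomial.aeval_def,
      MvPolynomial.hom_eval₂]
    have hC : (algebraMap S F).comp ((algebraMap A S).comp MvPolynomial.C) = algebraMap k F := by
      rw [← RingHom.comp_assoc, ← IsScalarTower.algebraMap_eq A S F]
      exact (IsScalarTower.algebraMap_eq k A F).symm
    rw [hC]
    congr 2
    funext s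
    rcases s with i | i
    · simp only [v, Sum.elim_inl, ← IsScalarTower.algebraMap_apply A S F]
      rfl
    · simp only [v, Sum.elim_inr, map_mul, ← IsScalarTower.algebraMap_apply A S F, hwF,
        div_eq_mul_inv]
      rfl
  have h2 := congrArg ε h1
  rw [map_mul, hε, MvPolynomial.hom_eval₂, map_one] at h2
  have hC : ε.comp ((algebraMap A S).comp MvPolynomial.C) = RingHom.id k :=
    RingHom.ext fun c => (hε _).trans (MvPolynomial.eval_C c)
  rw [hC, MvPolynomial.eval₂_id] at h2
  rw [← h2]
  congr 3
  funext s
  rcases s with i | i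
  · simp [v, hε]
  · simp [v, hε, hwk, div_eq_mul_inv]

theorem MvPolynomial.exists_norm_eval_le {τ : Type*} (Q : MvPolynomial τ ℂ) :
    ∃ M : ℝ, ∃ N : ℕ, 0 ≤ M ∧ ∀ (T : ℝ) (v : τ → ℂ), 1 ≤ T → (∀ s, ‖v s‖ ≤ T) →
      ‖MvPolynomial.eval v Q‖ ≤ M * T ^ N := by
  induction Q using MvPolynomial.induction_on with
  | C c => exact ⟨‖c‖, 0, norm_nonneg _, by simp⟩
  | add p q hp hq =>
    obtain ⟨M₁, N₁, h₁, hp⟩ := hp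
    obtain ⟨M₂, N₂, h₂, hq⟩ := hq
    refine ⟨M₁ + M₂, N₁ + N₂, add_nonneg h₁ h₂, fun T v hT hv => ?_⟩
    rw [map_add, add_mul]
    refine (norm_add_le _ _).trans (add_le_add ((hp T v hT hv).trans ?_) ((hq T v hT hv).trans ?_))
    · exact mul_le_mul_of_nonneg_left (pow_le_pow_right₀ hT (by omega)) h₁
    · exact mul_le_mul_of_nonneg_left (pow_le_pow_right₀ hT (by omega)) h₂
  | mul_X p i hp =>
    obtain ⟨M, N, h, hp⟩ := hp
    refine ⟨M, N + 1, h, fun T v hT hv => ?_⟩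
    rw [map_mul, norm_mul, MvPolynomial.eval_X, pow_succ, ← mul_assoc]
    have h0 : 0 ≤ T := by linarith
    exact mul_le_mul (hp T v hT hv) (hv i) (norm_nonneg _) (by positivity)

/-- A weak Łojasiewicz inequality for complex polynomials on a polydisc. -/
theorem MvPolynomial.exists_one_le_mul_norm_eval_mul_pow {σ : Type} [Fintype σ]
    (p : MvPolynomial σ ℂ) {R : ℝ} (hR : 1 ≤ R) :
    ∃ M : ℝ, ∃ N : ℕ, 0 ≤ M ∧ ∀ (q : σ → ℂ) (D : ℝ), (∀ i, ‖q i‖ ≤ R) →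
      MvPolynomial.eval q p ≠ 0 → 0 ≤ D →
      (∀ i, ‖MvPolynomial.eval q (MvPolynomial.pderiv i p)‖ ≤ D) →
      1 ≤ M * ‖MvPolynomial.eval q p‖ * (1 + D / ‖MvPolynomial.eval q p‖) ^ N := by
  by_cases hp : p = 0
  · exact ⟨0, 0, le_rfl, fun q D _ h => absurd (by simp [hp]) h⟩
  obtain ⟨Q, hQ⟩ := MvPolynomial.exists_eval_mul_eval_logDeriv_eq_one hp
  obtain ⟨M, N, hM, hMN⟩ := MvPolynomial.exists_norm_eval_le Q
  refine ⟨M * R ^ N, N, by positivity, fun q D hq hpq hD hd => ?_⟩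
  set y := ‖MvPolynomial.eval q p‖ with hy
  have hy0 : 0 < y := norm_pos_iff.2 hpq
  have hDy : 0 ≤ D / y := by positivity
  have h1 := hMN (R * (1 + D / y))
    (Sum.elim q fun i => MvPolynomial.eval q (MvPolynomial.pderiv i p) / MvPolynomial.eval q p)
    (by nlinarith) (by
      rintro (i | i)
      · exact (hq i).trans (by nlinarith)
      · simp only [Sum.elim_inr, norm_div, ← hy]
        have : ‖MvPolynomial.eval q (MvPolynomial.pderiv i p)‖ / y ≤ D / y := by
          gcongr
          exact hd i
        nlinarith)
  calc (1 : ℝ) = ‖(1 : ℂ)‖ := by simp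
    _ = y * _ := by rw [← hQ q hpq, norm_mul]
    _ ≤ y * (M * (R * (1 + D / y)) ^ N) := by gcongr
    _ = _ := by rw [mul_pow]; ring

theorem MvPolynomial.hasDerivAt_eval_update {σ : Type*} [DecidableEq σ] (p : MvPolynomial σ ℂ)
    (q : σ → ℝ) (j : σ) :
    HasDerivAt (fun t : ℝ => MvPolynomial.eval
        (fun i => ((Function.update q j (q j + t) i : ℝ) : ℂ)) p)
      (MvPolynomial.eval (fun i => (q i : ℂ)) (MvPolynomial.pderiv j p)) 0 := by
  have h0 : ∀ i, Function.update q j (q j + 0) i = q i := by simp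
  induction p using MvPolynomial.induction_on with
  | C c => simpa using hasDerivAt_const (0 : ℝ) c
  | add p r hp hr => simpa using hp.fun_add hr
  | mul_X p i hp =>
    have hX : HasDerivAt (fun t : ℝ => ((Function.update q j (q j + t) i : ℝ) : ℂ))
        ((Pi.single j (1 : ℂ) : σ → ℂ) i) 0 := by
      by_cases h : i = j
      · subst h
        simpa using ((hasDerivAt_id (0 : ℝ)).const_add (q i)).ofReal_comp
      · simpa [h] using hasDerivAt_const (0 : ℝ) ((q i : ℝ) : ℂ)
    have := hp.fun_mul hX
    simp only [h0] at this
    simp only [map_mul, MvPolynomial.eval_X, Derivation.leibniz, MvPolynomial.pderiv_X, map_add,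
      smul_eq_mul]
    refine this.congr_deriv ?_
    rw [Pi.single_apply, Pi.single_apply]
    split_ifs <;> simp <;> ring

/-- A complex valued function on real space given by a polynomial. -/
def IsPolyFun {σ : Type*} (F : (σ → ℝ) → ℂ) : Prop :=
  ∃ p : MvPolynomial σ ℂ, ∀ q, MvPolynomial.eval (fun i => (q i : ℂ)) p = F q

namespace IsPolyFun

variable {σ ι : Type*} {F G : (σ → ℝ) → ℂ}

theorem const (c : ℂ) : IsPolyFun fun _ : σ → ℝ => c := ⟨MvPolynomial.C c, by simp⟩

theorem coord (i : σ) : IsPolyFun fun q : σ → ℝ => (q i : ℂ) := ⟨MvPolynomial.X i, by simp⟩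

theorem add (hF : IsPolyFun F) (hG : IsPolyFun G) : IsPolyFun fun q => F q + G q := by
  obtain ⟨p, hp⟩ := hF
  obtain ⟨r, hr⟩ := hG
  exact ⟨p + r, by simp [hp, hr]⟩

theorem mul (hF : IsPolyFun F) (hG : IsPolyFun G) : IsPolyFun fun q => F q * G q := by
  obtain ⟨p, hp⟩ := hF
  obtain ⟨r, hr⟩ := hG
  exact ⟨p * r, by simp [hp, hr]⟩

theorem neg (hF : IsPolyFun F) : IsPolyFun fun q => -F q := by
  simpa using (const (-1)).mul hF

theorem sub (hF : IsPolyFun F) (hG : IsPolyFun G) : IsPolyFun fun q => F q - G q := by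
  simpa [sub_eq_add_neg] using hF.add hG.neg

theorem star (hF : IsPolyFun F) : IsPolyFun fun q => star (F q) := by
  obtain ⟨p, hp⟩ := hF
  refine ⟨MvPolynomial.map (starRingEnd ℂ) p, fun q => ?_⟩
  change _ = Star.star (F q)
  rw [← hp, MvPolynomial.eval_map, ← starRingEnd_apply, ← MvPolynomial.eval₂_id,
    MvPolynomial.hom_eval₂]
  simp

theorem sum {s : Finset ι} {F : ι → (σ → ℝ) → ℂ} (h : ∀ i ∈ s, IsPolyFun (F i)) :
    IsPolyFun fun q => ∑ i ∈ s, F i q := by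
  classical
  induction s using Finset.induction_on with
  | empty => simpa using const 0
  | insert a s ha ih =>
    simp only [Finset.sum_insert ha]
    exact (h a (by simp)).add (ih fun i hi => h i (by simp [hi]))

theorem prod {s : Finset ι} {F : ι → (σ → ℝ) → ℂ} (h : ∀ i ∈ s, IsPolyFun (F i)) :
    IsPolyFun fun q => ∏ i ∈ s, F i q := by
  classical
  induction s using Finset.induction_on with
  | empty => simpa using const 1
  | insert a s ha ih =>
    simp only [Finset.prod_insert ha]
    exact (h a (by simp)).mul (ih fun i hi => h i (by simp [hi]))

theorem re (hF : IsPolyFun F) : IsPolyFun fun q => ((F q).re : ℂ) := by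
  have := (const (1 / 2)).mul (hF.add hF.star)
  convert this using 2 with q
  rw [Complex.star_def, Complex.add_conj]
  push_cast
  ring

end IsPolyFun

/-- A weak Łojasiewicz inequality for real polynomial functions on a cube. -/
theorem IsPolyFun.exists_one_le_mul_abs_mul_pow {σ : Type} [Fintype σ] [DecidableEq σ]
    {Φ : (σ → ℝ) → ℝ} (hΦ : IsPolyFun fun q => (Φ q : ℂ)) {R : ℝ} (hR : 1 ≤ R) :
    ∃ M : ℝ, ∃ N : ℕ, 0 ≤ M ∧ ∀ (q : σ → ℝ) (D : ℝ), (∀ i, |q i| ≤ R) → Φ q ≠ 0 → 0 ≤ D →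
      (∀ i, ∃ d, HasDerivAt (fun t => Φ (Function.update q i (q i + t))) d 0 ∧ |d| ≤ D) →
      1 ≤ M * |Φ q| * (1 + D / |Φ q|) ^ N := by
  obtain ⟨p, hp⟩ := hΦ
  obtain ⟨M, N, hM, h⟩ := MvPolynomial.exists_one_le_mul_norm_eval_mul_pow p hR
  refine ⟨M, N, hM, fun q D hq hΦq hD hd => ?_⟩
  have := h (fun i => (q i : ℂ)) D (by simpa using hq) (by simpa [hp] using hΦq) hD fun i => by
    obtain ⟨d, hd, hdD⟩ := hd i
    have h1 := MvPolynomial.hasDerivAt_eval_update p q i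
    simp only [hp] at h1
    rw [h1.unique hd.ofReal_comp]
    simpa using hdD
  simpa [hp] using this

theorem norm_sub_le_of_norm_deriv_le_deriv {E : Type*} [NormedAddCommGroup E] [NormedSpace ℝ E]
    {u u' : ℝ → E} {ψ ψ' : ℝ → ℝ} {a b : ℝ} (hab : a ≤ b)
    (hu : ∀ t ∈ Set.Icc a b, HasDerivAt u (u' t) t)
    (hψ : ∀ t ∈ Set.Icc a b, HasDerivAt ψ (ψ' t) t)
    (h : ∀ t ∈ Set.Icc a b, ‖u' t‖ ≤ ψ' t) : ‖u b - u a‖ ≤ ψ b - ψ a := by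
  refine image_norm_le_of_norm_deriv_right_le_deriv_boundary' (f := fun t => u t - u a)
    (B := fun t => ψ t - ψ a) (f' := u') (B' := ψ') (a := a) (b := b) ?_ ?_ (by simp) ?_ ?_ ?_
    ⟨hab, le_rfl⟩
  · exact fun t ht => ((hu t ht).continuousAt.sub continuousAt_const).continuousWithinAt
  · exact fun t ht => ((hu t ⟨ht.1, ht.2.le⟩).sub_const _).hasDerivWithinAt
  · exact fun t ht => ((hψ t ht).continuousAt.sub continuousAt_const).continuousWithinAt
  · exact fun t ht => ((hψ t ⟨ht.1, ht.2.le⟩).sub_const _).hasDerivWithinAt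
  · exact fun t ht => h t ⟨ht.1, ht.2.le⟩

theorem exists_le_mul_rpow_mul_of_one_le {C₁ M : ℝ} (hC₁ : 0 ≤ C₁) (hM : 0 ≤ M) (N : ℕ) :
    ∃ B θ : ℝ, 0 ≤ B ∧ 0 < θ ∧ ∀ y r : ℝ, 0 < y → 0 ≤ r → M * y * 6 ^ (N + 1) < 1 →
      1 ≤ M * y * (3 + C₁ * r / y) ^ N → 1 ≤ B * y ^ (θ - 1) * r := by
  refine ⟨(M * 2 ^ (N + 1)) ^ ((N + 1 : ℝ)⁻¹) * C₁, (N + 1 : ℝ)⁻¹, by positivity, by positivity,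
    fun y r hy hr hsmall h => ?_⟩
  set x := C₁ * r / y with hx
  have hx0 : 0 ≤ x := by positivity
  have h1 : 1 ≤ M * y * (3 + x) ^ (N + 1) := by
    refine h.trans ?_
    gcongr
    · linarith
    · omega
  have hx3 : 3 < x := by
    by_contra! hx3
    have : M * y * (3 + x) ^ (N + 1) ≤ M * y * 6 ^ (N + 1) := by
      gcongr
      linarith
    linarith
  have h2 : 1 ≤ (M * 2 ^ (N + 1)) * y * x ^ (N + 1) := by
    calc 1 ≤ M * y * (3 + x) ^ (N + 1) := h1
      _ ≤ M * y * (2 * x) ^ (N + 1) := by gcongr; linarith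
      _ = _ := by rw [mul_pow]; ring
  have h3 := Real.one_le_rpow h2 (show 0 ≤ (N + 1 : ℝ)⁻¹ by positivity)
  rw [Real.mul_rpow (by positivity) (by positivity), Real.mul_rpow (by positivity) hy.le] at h3
  have h4 : (x ^ (N + 1)) ^ ((N + 1 : ℝ)⁻¹) = x := by
    have := Real.pow_rpow_inv_natCast hx0 (n := N + 1) (by omega)
    push_cast at this
    exact this
  rw [h4] at h3
  rw [Real.rpow_sub_one hy.ne']
  refine h3.trans_eq ?_
  rw [hx]
  ring

/-- A gradient-like curve satisfying a Łojasiewicz inequality converges. -/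
theorem exists_tendsto_of_lojasiewicz {E : Type*} [NormedAddCommGroup E] [NormedSpace ℝ E]
    [CompleteSpace E] {u u' : ℝ → E} {y d ρ : ℝ → ℝ} {C₁ C₂ M : ℝ} {N : ℕ}
    (hC₁ : 0 ≤ C₁) (hC₂ : 0 ≤ C₂) (hM : 0 ≤ M)
    (hu : ∀ t, 0 ≤ t → HasDerivAt u (u' t) t) (hy : ∀ t, 0 ≤ t → HasDerivAt y (-d t) t)
    (hρ : ∀ t, 0 ≤ t → 0 ≤ ρ t) (hd : ∀ t, 0 ≤ t → ρ t ^ 2 ≤ d t)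
    (hu' : ∀ t, 0 ≤ t → ‖u' t‖ ≤ C₂ * ρ t) (hy0 : ∀ t, 0 ≤ t → 0 ≤ y t)
    (hlim : Tendsto y atTop (𝓝 0))
    (hL : ∀ t, 0 ≤ t → 0 < y t → 1 ≤ M * y t * (3 + C₁ * ρ t / y t) ^ N) :
    ∃ a, Tendsto u atTop (𝓝 a) := by
  have hd0 : ∀ t, 0 ≤ t → 0 ≤ d t := fun t ht => (sq_nonneg _).trans (hd t ht)
  have hanti : AntitoneOn y (Set.Ici 0) := by
    refine antitoneOn_of_deriv_nonpos (convex_Ici 0)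
      (fun t ht => (hy t ht).continuousAt.continuousWithinAt)
      (fun t ht => (hy t (interior_subset ht)).differentiableAt.differentiableWithinAt) fun t ht => ?_
    rw [(hy t (interior_subset ht)).deriv]
    linarith [hd0 t (interior_subset ht)]
  suffices h : ∃ (T : ℝ) (ψ ψ' : ℝ → ℝ), 0 ≤ T ∧ (∀ t, T ≤ t → 0 ≤ ψ t) ∧ Tendsto ψ atTop (𝓝 0) ∧
      (∀ t, T ≤ t → HasDerivAt ψ (ψ' t) t) ∧ ∀ t, T ≤ t → ‖u' t‖ ≤ -ψ' t by
    obtain ⟨T, ψ, ψ', hT, hψ0, hψlim, hψ, hψ'⟩ := h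
    have key : ∀ s t, T ≤ s → s ≤ t → ‖u t - u s‖ ≤ ψ s := by
      intro s t hs hst
      have := norm_sub_le_of_norm_deriv_le_deriv hst
        (fun r hr => hu r (hT.trans (hs.trans hr.1)))
        (fun r hr => (hψ r (hs.trans hr.1)).neg) (fun r hr => hψ' r (hs.trans hr.1))
      simp only [Pi.neg_apply] at this
      linarith [hψ0 t (hs.trans hst)]
    have hmax : Tendsto (fun t : ℝ => max t T) atTop atTop :=
      tendsto_atTop_mono (fun t => le_max_left t T) tendsto_id
    have hc : CauchySeq fun t => u (max t T) := by
      refine cauchySeq_of_le_tendsto_0 (fun s => 2 * ψ (max s T)) (fun n m s hn hm => ?_) ?_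
      · have h1 := key (max s T) (max n T) (le_max_right _ _) (max_le_max_right T hn)
        have h2 := key (max s T) (max m T) (le_max_right _ _) (max_le_max_right T hm)
        rw [← dist_eq_norm] at h1 h2
        linarith [dist_triangle_right (u (max n T)) (u (max m T)) (u (max s T))]
      · simpa using (hψlim.comp hmax).const_mul 2
    obtain ⟨a, ha⟩ := cauchySeq_tendsto_of_complete hc
    refine ⟨a, ha.congr' ?_⟩
    filter_upwards [eventually_ge_atTop T] with t ht
    rw [max_eq_left ht]
  by_cases hz : ∃ t₀, 0 ≤ t₀ ∧ y t₀ = 0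
  · obtain ⟨t₀, ht₀, hyt₀⟩ := hz
    refine ⟨t₀ + 1, fun _ => 0, fun _ => 0, by linarith, by simp, tendsto_const_nhds,
      fun t _ => hasDerivAt_const t 0, fun t ht => ?_⟩
    have h0t : 0 ≤ t := by linarith
    have hev : y =ᶠ[𝓝 t] fun _ => 0 := by
      filter_upwards [eventually_gt_nhds (show t₀ < t by linarith)] with s hs
      have h0s : 0 ≤ s := ht₀.trans hs.le
      exact le_antisymm (hyt₀ ▸ hanti ht₀ h0s hs.le) (hy0 s h0s)
    have hdt : -d t = 0 := (hy t h0t).unique ((hasDerivAt_const t (0 : ℝ)).congr_of_eventuallyEq hev)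
    have hρt : ρ t = 0 := by
      have := hd t h0t
      nlinarith [sq_nonneg (ρ t)]
    simpa [hρt] using hu' t h0t
  · push Not at hz
    have hpos : ∀ t, 0 ≤ t → 0 < y t := fun t ht => lt_of_le_of_ne (hy0 t ht) (hz t ht).symm
    obtain ⟨B, θ, hB, hθ, hBθ⟩ := exists_le_mul_rpow_mul_of_one_le hC₁ hM N
    have hsmall : ∀ᶠ t in atTop, M * y t * 6 ^ (N + 1) < 1 := by
      have : Tendsto (fun t => M * y t * 6 ^ (N + 1)) atTop (𝓝 0) := by
        simpa using (hlim.const_mul M).mul_const ((6 : ℝ) ^ (N + 1))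
      exact this.eventually (gt_mem_nhds one_pos)
    obtain ⟨T, hTT⟩ := (hsmall.and (eventually_ge_atTop (0 : ℝ))).exists_forall_of_atTop
    have hT0 : 0 ≤ T := (hTT T le_rfl).2
    have hT : ∀ t, T ≤ t → M * y t * 6 ^ (N + 1) < 1 := fun t ht => (hTT t ht).1
    refine ⟨T, fun t => C₂ * B / θ * y t ^ θ, fun t => C₂ * B / θ * (-d t * θ * y t ^ (θ - 1)), hT0,
      fun t ht => ?_, ?_, fun t ht => ?_, fun t ht => ?_⟩
    · have := hy0 t (hT0.trans ht)
      positivity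
    · have := (hlim.rpow_const (Or.inr hθ.le)).const_mul (C₂ * B / θ)
      simpa [Real.zero_rpow hθ.ne'] using this
    · exact ((hy t (hT0.trans ht)).rpow_const (Or.inl (hpos t (hT0.trans ht)).ne')).const_mul _
    · have h0t := hT0.trans ht
      have h1 := hBθ (y t) (ρ t) (hpos t h0t) (hρ t h0t) (hT t ht) (hL t h0t (hpos t h0t))
      have hyp : 0 < y t ^ (θ - 1) := Real.rpow_pos_of_pos (hpos t h0t) _
      have hρt := hρ t h0t
      calc ‖u' t‖ ≤ C₂ * ρ t := hu' t h0t
        _ ≤ C₂ * ρ t * (B * y t ^ (θ - 1) * ρ t) := le_mul_of_one_le_right (by positivity) h1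
        _ = C₂ * B * y t ^ (θ - 1) * ρ t ^ 2 := by ring
        _ ≤ C₂ * B * y t ^ (θ - 1) * d t := by
          gcongr
          exact hd t h0t
        _ = _ := by field_simp

section Norm

variable {m : Type*} [Fintype m]

theorem Matrix.norm_mul_le_card_mul (M N : Matrix m m ℂ) :
    ‖M * N‖ ≤ Fintype.card m * (‖M‖ * ‖N‖) := by
  rw [Matrix.norm_le_iff (by positivity)]
  intro i j
  rw [mul_apply]
  refine (norm_sum_le _ _).trans ?_
  refine (Finset.sum_le_card_nsmul _ _ (‖M‖ * ‖N‖) fun k _ => ?_).trans_eq (by simp)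
  rw [norm_mul]
  exact mul_le_mul (norm_entry_le_entrywise_sup_norm M) (norm_entry_le_entrywise_sup_norm N)
    (norm_nonneg _) (norm_nonneg _)

theorem Matrix.abs_re_trace_le (M : Matrix m m ℂ) : |M.trace.re| ≤ Fintype.card m * ‖M‖ := by
  refine (Complex.abs_re_le_norm _).trans ((norm_sum_le _ _).trans ?_)
  refine (Finset.sum_le_card_nsmul _ _ ‖M‖ fun k _ => ?_).trans_eq (by simp)
  exact norm_entry_le_entrywise_sup_norm M

theorem Matrix.abs_re_trace_conjTranspose_mul_le (M N : Matrix m m ℂ) :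
    |(Mᴴ * N).trace.re| ≤ (Fintype.card m) ^ 2 * (‖M‖ * ‖N‖) := by
  refine (abs_re_trace_le _).trans ?_
  have := norm_mul_le_card_mul Mᴴ N
  rw [Matrix.norm_conjTranspose] at this
  calc _ ≤ (Fintype.card m : ℝ) * (Fintype.card m * (‖M‖ * ‖N‖)) := by gcongr
    _ = _ := by ring

theorem Matrix.norm_sq_le_re_trace (M : Matrix m m ℂ) : ‖M‖ ^ 2 ≤ (Mᴴ * M).trace.re := by
  have h : (Mᴴ * M).trace.re = ∑ j, ∑ i, ‖M i j‖ ^ 2 := by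
    simp only [trace, diag_apply, mul_apply, conjTranspose_apply, Complex.re_sum]
    refine Finset.sum_congr rfl fun j _ => Finset.sum_congr rfl fun i _ => ?_
    rw [Complex.star_def, ← Complex.normSq_eq_conj_mul_self, Complex.ofReal_re,
      Complex.normSq_eq_norm_sq]
  have h0 : 0 ≤ (Mᴴ * M).trace.re := h ▸ by positivity
  rw [← Real.le_sqrt (norm_nonneg _) h0, Matrix.norm_le_iff (Real.sqrt_nonneg _)]
  intro i j
  rw [Real.le_sqrt (norm_nonneg _) h0, h]
  calc ‖M i j‖ ^ 2 ≤ ∑ i, ‖M i j‖ ^ 2 :=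
        Finset.single_le_sum (f := fun i => ‖M i j‖ ^ 2) (fun _ _ => by positivity)
          (Finset.mem_univ i)
    _ ≤ _ := Finset.single_le_sum (f := fun j => ∑ i, ‖M i j‖ ^ 2) (fun _ _ => by positivity)
          (Finset.mem_univ j)

end Norm

section Kron

variable {n : ℕ}

/-- The `n`-fold Kronecker product of `2 × 2` matrices. -/
def kron (K : Fin n → Matrix (Fin 2) (Fin 2) ℂ) : Matrix (Fin n → Fin 2) (Fin n → Fin 2) ℂ :=
  Matrix.of fun i j => ∏ k, K k (i k) (j k)

theorem kron_mul_kron (K L : Fin n → Matrix (Fin 2) (Fin 2) ℂ) :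
    kron K * kron L = kron fun k => K k * L k := by
  ext i j
  simp only [kron, mul_apply, of_apply, ← Finset.prod_mul_distrib]
  rw [Finset.prod_univ_sum, Fintype.piFinset_univ]

theorem conjTranspose_kron (K : Fin n → Matrix (Fin 2) (Fin 2) ℂ) :
    (kron K)ᴴ = kron fun k => (K k)ᴴ := by
  ext i j
  simp [kron]

theorem localOp_eq_kron (k : Fin n) (M : Matrix (Fin 2) (Fin 2) ℂ) :
    localOp n k M = kron (Function.update (fun _ => 1) k M) := by
  ext i j
  rw [kron, localOp, of_apply, of_apply, ← Finset.mul_prod_erase _ _ (Finset.mem_univ k)]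
  simp only [Function.update_self]
  congr 1
  refine Finset.prod_congr rfl fun l hl => ?_
  rw [Function.update_of_ne (Finset.ne_of_mem_erase hl), one_apply]

theorem localOp_mul_kron (k : Fin n) (M : Matrix (Fin 2) (Fin 2) ℂ)
    (K : Fin n → Matrix (Fin 2) (Fin 2) ℂ) :
    localOp n k M * kron K = kron (Function.update K k (M * K k)) := by
  rw [localOp_eq_kron, kron_mul_kron]
  congr 1
  ext1 l
  by_cases h : l = k
  · subst h; simp
  · simp [h]

theorem kron_one : kron (fun _ : Fin n => (1 : Matrix (Fin 2) (Fin 2) ℂ)) = 1 := by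
  ext i j
  simp only [kron, of_apply, one_apply, Finset.prod_ite_zero, Finset.prod_const_one,
    funext_iff, Finset.mem_univ, true_imp_iff]

theorem localOp_one (k : Fin n) : localOp n k 1 = 1 := by
  rw [localOp_eq_kron, Function.update_eq_self_iff.2 rfl, kron_one]

theorem localOp_add (k : Fin n) (M N : Matrix (Fin 2) (Fin 2) ℂ) :
    localOp n k (M + N) = localOp n k M + localOp n k N := by
  ext i j
  simp [localOp, add_mul]

theorem localOp_smul (k : Fin n) (c : ℂ) (M : Matrix (Fin 2) (Fin 2) ℂ) :
    localOp n k (c • M) = c • localOp n k M := by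
  ext i j
  simp [localOp, mul_assoc]

theorem localOp_sub (k : Fin n) (M N : Matrix (Fin 2) (Fin 2) ℂ) :
    localOp n k (M - N) = localOp n k M - localOp n k N := by
  ext i j
  simp [localOp, sub_mul]

theorem conjTranspose_localOp (k : Fin n) (M : Matrix (Fin 2) (Fin 2) ℂ) :
    (localOp n k M)ᴴ = localOp n k Mᴴ := by
  ext i j
  simp [localOp, eq_comm]

theorem norm_localOp_le (k : Fin n) (M : Matrix (Fin 2) (Fin 2) ℂ) : ‖localOp n k M‖ ≤ ‖M‖ := by
  rw [Matrix.norm_le_iff (norm_nonneg _)]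
  intro i j
  rw [localOp, of_apply, norm_mul, Finset.prod_ite_zero, Finset.prod_const_one]
  refine (mul_le_of_le_one_right (norm_nonneg _) ?_).trans (norm_entry_le_entrywise_sup_norm M)
  split_ifs <;> simp

theorem localOp_mem_suLoc (k : Fin n) {M : Matrix (Fin 2) (Fin 2) ℂ} (h : Mᴴ = -M)
    (h' : M.trace = 0) : localOp n k M ∈ suLoc n := by
  refine ⟨Pi.single k M, fun l => ?_, ?_⟩
  · by_cases hl : l = k
    · subst hl; simp [h, h']
    · simp [hl]
  · rw [Finset.sum_eq_single k _ (by simp)]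
    · simp
    · intro l _ hl
      ext i j
      simp [hl, localOp]

theorem sub_mem_suLoc {g h : Matrix (Fin n → Fin 2) (Fin n → Fin 2) ℂ} (hg : g ∈ suLoc n)
    (hh : h ∈ suLoc n) : g - h ∈ suLoc n := by
  obtain ⟨Ω, hΩ, rfl⟩ := hg
  obtain ⟨Ξ, hΞ, rfl⟩ := hh
  refine ⟨fun k => Ω k - Ξ k, fun k => ⟨?_, ?_⟩, ?_⟩
  · rw [conjTranspose_sub, (hΩ k).1, (hΞ k).1, neg_sub_neg, neg_sub]
  · rw [trace_sub, (hΩ k).2, (hΞ k).2, sub_zero]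
  · simp [localOp_sub]

theorem conjTranspose_of_mem_suLoc {g : Matrix (Fin n → Fin 2) (Fin n → Fin 2) ℂ}
    (hg : g ∈ suLoc n) : gᴴ = -g := by
  obtain ⟨Ω, hΩ, rfl⟩ := hg
  rw [conjTranspose_sum, ← Finset.sum_neg_distrib]
  refine Finset.sum_congr rfl fun k _ => ?_
  rw [conjTranspose_localOp, (hΩ k).1, ← neg_one_smul ℂ, localOp_smul, neg_one_smul]

theorem mem_SUloc_iff {V : Matrix (Fin n → Fin 2) (Fin n → Fin 2) ℂ} :
    V ∈ SUloc n ↔ ∃ K : Fin n → Matrix (Fin 2) (Fin 2) ℂ,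
      (∀ k, K k ∈ Matrix.specialUnitaryGroup (Fin 2) ℂ) ∧ V = kron K := Iff.rfl

theorem mul_mem_SUloc {V W : Matrix (Fin n → Fin 2) (Fin n → Fin 2) ℂ} (hV : V ∈ SUloc n)
    (hW : W ∈ SUloc n) : V * W ∈ SUloc n := by
  obtain ⟨K, hK, rfl⟩ := mem_SUloc_iff.1 hV
  obtain ⟨L, hL, rfl⟩ := mem_SUloc_iff.1 hW
  exact mem_SUloc_iff.2 ⟨_, fun k => mul_mem (hK k) (hL k), kron_mul_kron K L⟩

theorem conjTranspose_mul_self_of_mem_SUloc {V : Matrix (Fin n → Fin 2) (Fin n → Fin 2) ℂ}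
    (hV : V ∈ SUloc n) : Vᴴ * V = 1 := by
  obtain ⟨K, hK, rfl⟩ := mem_SUloc_iff.1 hV
  rw [conjTranspose_kron, kron_mul_kron, ← kron_one]
  congr 1
  ext1 k
  exact mem_unitaryGroup_iff'.1 (mem_specialUnitaryGroup_iff.1 (hK k)).1

theorem continuous_kron :
    Continuous (kron : (Fin n → Matrix (Fin 2) (Fin 2) ℂ) → _) := by
  refine continuous_matrix fun i j => ?_
  simp only [kron, of_apply]
  fun_prop

theorem norm_le_one_of_mem_specialUnitaryGroup {M : Matrix (Fin 2) (Fin 2) ℂ}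
    (hM : M ∈ Matrix.specialUnitaryGroup (Fin 2) ℂ) : ‖M‖ ≤ 1 :=
  entrywise_sup_norm_bound_of_unitary (mem_specialUnitaryGroup_iff.1 hM).1

theorem isCompact_SUloc (n : ℕ) : IsCompact (SUloc n) := by
  have h1 : IsCompact {M : Matrix (Fin 2) (Fin 2) ℂ | M ∈ Matrix.specialUnitaryGroup (Fin 2) ℂ} := by
    refine Metric.isCompact_of_isClosed_isBounded ?_ ?_
    · simp only [mem_specialUnitaryGroup_iff, mem_unitaryGroup_iff]
      refine IsClosed.inter (isClosed_eq ?_ continuous_const) (isClosed_eq ?_ continuous_const)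
      · exact continuous_id.matrix_mul (continuous_id.star)
      · exact continuous_id.matrix_det
    · exact (Metric.isBounded_closedBall (x := (0 : Matrix (Fin 2) (Fin 2) ℂ)) (r := 1)).subset
        fun M hM => by simpa using norm_le_one_of_mem_specialUnitaryGroup hM
  have h2 := (isCompact_univ_pi fun _ : Fin n => h1).image continuous_kron
  convert h2 using 1
  ext V
  simp [mem_SUloc_iff, eq_comm]

theorem SUloc_nonempty (n : ℕ) : (SUloc n).Nonempty :=
  ⟨1, mem_SUloc_iff.2 ⟨fun _ => 1, fun _ => one_mem _, kron_one.symm⟩⟩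

theorem norm_le_one_of_mem_SUloc {V : Matrix (Fin n → Fin 2) (Fin n → Fin 2) ℂ}
    (hV : V ∈ SUloc n) : ‖V‖ ≤ 1 :=
  entrywise_sup_norm_bound_of_unitary
    (mem_unitaryGroup_iff'.2 (conjTranspose_mul_self_of_mem_SUloc hV))

end Kron

section Gradient

variable {m : Type*} [Fintype m]

theorem HasDerivAt.matrix_mul {U V : ℝ → Matrix m m ℂ} {U' V' : Matrix m m ℂ} {t : ℝ}
    (hU : HasDerivAt U U' t) (hV : HasDerivAt V V' t) :
    HasDerivAt (fun s => U s * V s) (U' * V t + U t * V') t := by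
  refine hasDerivAt_pi.2 fun i => hasDerivAt_pi.2 fun j => ?_
  simp only [mul_apply, Matrix.add_apply, ← Finset.sum_add_distrib]
  exact HasDerivAt.fun_sum fun k _ =>
    (hasDerivAt_pi.1 (hasDerivAt_pi.1 hU i) k).fun_mul (hasDerivAt_pi.1 (hasDerivAt_pi.1 hV k) j)

theorem HasDerivAt.matrix_conjTranspose {U : ℝ → Matrix m m ℂ} {U' : Matrix m m ℂ} {t : ℝ}
    (hU : HasDerivAt U U' t) : HasDerivAt (fun s => (U s)ᴴ) U'ᴴ t :=
  hasDerivAt_pi.2 fun i => hasDerivAt_pi.2 fun j =>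
    (hasDerivAt_pi.1 (hasDerivAt_pi.1 hU j) i).star

theorem HasDerivAt.matrix_re_trace {U : ℝ → Matrix m m ℂ} {U' : Matrix m m ℂ} {t : ℝ}
    (hU : HasDerivAt U U' t) : HasDerivAt (fun s => (U s).trace.re) U'.trace.re t := by
  simp only [trace, diag_apply, Complex.re_sum]
  exact HasDerivAt.fun_sum fun k _ =>
    Complex.reCLM.hasFDerivAt.comp_hasDerivAt t (hasDerivAt_pi.1 (hasDerivAt_pi.1 hU k) k)

/-- The objective function `Re tr (C† U A U†)`. -/
def overlap (A C U : Matrix m m ℂ) : ℝ := (Cᴴ * (U * A * Uᴴ)).trace.re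

/-- The commutator `[C†, U A U†]`. -/
def overlapGrad (A C U : Matrix m m ℂ) : Matrix m m ℂ :=
  Cᴴ * (U * A * Uᴴ) - (U * A * Uᴴ) * Cᴴ

theorem continuous_overlap (A C : Matrix m m ℂ) : Continuous (overlap A C) := by
  unfold overlap
  refine Complex.continuous_re.comp (Continuous.matrix_trace ?_)
  exact continuous_const.matrix_mul
    ((continuous_id.matrix_mul continuous_const).matrix_mul continuous_id.matrix_conjTranspose)

theorem continuous_overlapGrad (A C : Matrix m m ℂ) : Continuous (overlapGrad A C) := by
  unfold overlapGrad
  have h : Continuous fun U : Matrix m m ℂ => U * A * Uᴴ :=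
    (continuous_id.matrix_mul continuous_const).matrix_mul continuous_id.matrix_conjTranspose
  exact (continuous_const.matrix_mul h).sub (h.matrix_mul continuous_const)

theorem re_trace_overlap_deriv [DecidableEq m] (A C B : Matrix m m ℂ) {Ω : Matrix m m ℂ} (w : ℝ)
    (hΩ : Ωᴴ = -Ω) :
    (Cᴴ * (((w : ℂ) • 1 + Ω) * B * A * Bᴴ + B * A * (((w : ℂ) • 1 + Ω) * B)ᴴ)).trace.re =
      2 * w * overlap A C B + (Ωᴴ * overlapGrad A C B).trace.re := by
  have e : Cᴴ * (((w : ℂ) • 1 + Ω) * B * A * Bᴴ + B * A * (((w : ℂ) • 1 + Ω) * B)ᴴ) =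
      ((2 * w : ℝ) : ℂ) • (Cᴴ * (B * A * Bᴴ)) +
      (Cᴴ * (Ω * (B * A * Bᴴ)) - Cᴴ * (B * A * Bᴴ) * Ω) := by
    rw [conjTranspose_mul, conjTranspose_add, hΩ, conjTranspose_smul, conjTranspose_one]
    simp only [Complex.star_def, Complex.conj_ofReal, Matrix.add_mul,
      Matrix.mul_add, Matrix.smul_mul, Matrix.mul_smul, Matrix.one_mul, Matrix.mul_one,
      Matrix.mul_neg, Matrix.mul_assoc]
    push_cast
    module
  rw [e, hΩ, overlapGrad, overlap, trace_add, trace_sub, trace_smul, Matrix.neg_mul, trace_neg,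
    Matrix.mul_sub, trace_sub, trace_mul_comm Cᴴ (Ω * _), trace_mul_comm _ Ω]
  simp only [Complex.add_re, Complex.sub_re, Complex.neg_re, smul_eq_mul, Complex.re_ofReal_mul,
    Matrix.mul_assoc]
  ring

theorem HasDerivAt.overlap [DecidableEq m] {A C : Matrix m m ℂ} {V : ℝ → Matrix m m ℂ}
    {Ω : Matrix m m ℂ} {w t : ℝ} (hV : HasDerivAt V (((w : ℂ) • 1 + Ω) * V t) t) (hΩ : Ωᴴ = -Ω) :
    HasDerivAt (fun s => _root_.overlap A C (V s))
      (2 * w * _root_.overlap A C (V t) + (Ωᴴ * overlapGrad A C (V t)).trace.re) t := by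
  have h := ((hasDerivAt_const t Cᴴ).matrix_mul
    ((hV.matrix_mul (hasDerivAt_const t A)).matrix_mul hV.matrix_conjTranspose)).matrix_re_trace
  rw [Matrix.zero_mul, zero_add, Matrix.mul_zero, add_zero, re_trace_overlap_deriv A C _ w hΩ] at h
  exact h

end Gradient

/-- `P` is the orthogonal projection onto `suLoc n` for the real trace inner product. -/
structure IsSuLocProj {n : ℕ} (P : Matrix (Fin n → Fin 2) (Fin n → Fin 2) ℂ →
    Matrix (Fin n → Fin 2) (Fin n → Fin 2) ℂ) : Prop where
  mem : ∀ g, P g ∈ suLoc n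
  re_trace_eq_zero : ∀ g, ∀ h ∈ suLoc n, (((g - P g)ᴴ * h).trace).re = 0

namespace IsSuLocProj

variable {n : ℕ} {P : Matrix (Fin n → Fin 2) (Fin n → Fin 2) ℂ →
    Matrix (Fin n → Fin 2) (Fin n → Fin 2) ℂ}

theorem re_trace_conjTranspose_mul (hP : IsSuLocProj P)
    {h : Matrix (Fin n → Fin 2) (Fin n → Fin 2) ℂ} (hh : h ∈ suLoc n)
    (g : Matrix (Fin n → Fin 2) (Fin n → Fin 2) ℂ) :
    (hᴴ * P g).trace.re = (hᴴ * g).trace.re := by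
  have h1 := hP.re_trace_eq_zero g h hh
  have h2 : ((g - P g)ᴴ * h).trace = star (hᴴ * (g - P g)).trace := by
    rw [← trace_conjTranspose, conjTranspose_mul, conjTranspose_conjTranspose]
  rw [h2, Complex.star_def, Complex.conj_re, Matrix.mul_sub, trace_sub, Complex.sub_re] at h1
  linarith

theorem norm_sub_le (hP : IsSuLocProj P) (g h : Matrix (Fin n → Fin 2) (Fin n → Fin 2) ℂ) :
    ‖P g - P h‖ ≤ (Fintype.card (Fin n → Fin 2)) ^ 2 * ‖g - h‖ := by
  set D := P g - P h with hD
  have hmem : D ∈ suLoc n := sub_mem_suLoc (hP.mem g) (hP.mem h)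
  have h1 : (Dᴴ * D).trace.re = (Dᴴ * (g - h)).trace.re := by
    conv_lhs => rw [hD, Matrix.mul_sub, trace_sub, Complex.sub_re, ← hD]
    rw [Matrix.mul_sub, trace_sub, Complex.sub_re, hP.re_trace_conjTranspose_mul hmem,
      hP.re_trace_conjTranspose_mul hmem]
  have h2 := norm_sq_le_re_trace D
  have h3 := (le_abs_self _).trans (abs_re_trace_conjTranspose_mul_le D (g - h))
  rw [h1] at h2
  rcases (norm_nonneg D).eq_or_lt with h0 | h0
  · rw [← h0]; positivity
  · refine le_of_mul_le_mul_left ?_ h0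
    linarith

theorem continuous (hP : IsSuLocProj P) : Continuous P := by
  refine LipschitzWith.continuous (K := (Fintype.card (Fin n → Fin 2) : NNReal) ^ 2)
    (LipschitzWith.of_dist_le_mul fun g h => ?_)
  rw [dist_eq_norm, dist_eq_norm]
  simpa using hP.norm_sub_le g h

end IsSuLocProj

section Quaternion

/-- The matrix of the quaternion with the given real coordinates. -/
def quat (q : Fin 4 → ℝ) : Matrix (Fin 2) (Fin 2) ℂ :=
  !![(q 0 : ℂ) + q 1 * Complex.I, (q 2 : ℂ) + q 3 * Complex.I;
     -(q 2 : ℂ) + q 3 * Complex.I, (q 0 : ℂ) - q 1 * Complex.I]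

theorem quat_mul_conjTranspose (p q : Fin 4 → ℝ) :
    quat p * (quat q)ᴴ =
      quat ![p 0 * q 0 + p 1 * q 1 + p 2 * q 2 + p 3 * q 3,
        p 1 * q 0 - p 0 * q 1 + p 3 * q 2 - p 2 * q 3,
        p 2 * q 0 - p 0 * q 2 + p 1 * q 3 - p 3 * q 1,
        p 3 * q 0 - p 0 * q 3 + p 2 * q 1 - p 1 * q 2] := by
  ext i j
  fin_cases i <;> fin_cases j <;> simp [quat, mul_apply, Complex.ext_iff] <;> constructor <;> ring

theorem quat_mul_conjTranspose_self (q : Fin 4 → ℝ) :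
    quat q * (quat q)ᴴ = ((∑ b, q b ^ 2 : ℝ) : ℂ) • 1 := by
  rw [quat_mul_conjTranspose]
  ext i j
  fin_cases i <;> fin_cases j <;> simp [quat, Fin.sum_univ_four, Complex.ext_iff, pow_two] <;>
    ring_nf <;> simp

theorem quat_mem_specialUnitaryGroup {q : Fin 4 → ℝ} (hq : ∑ b, q b ^ 2 = 1) :
    quat q ∈ Matrix.specialUnitaryGroup (Fin 2) ℂ := by
  rw [mem_specialUnitaryGroup_iff, mem_unitaryGroup_iff, star_eq_conjTranspose,
    quat_mul_conjTranspose_self, hq]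
  refine ⟨by simp, ?_⟩
  rw [← Complex.ofReal_one, ← hq, quat, det_fin_two_of]
  simp [Complex.ext_iff, Fin.sum_univ_succ, -Complex.ofReal_pow, pow_two]
  ring_nf
  simp

theorem exists_quat_eq {M : Matrix (Fin 2) (Fin 2) ℂ}
    (hM : M ∈ Matrix.specialUnitaryGroup (Fin 2) ℂ) :
    ∃ q : Fin 4 → ℝ, ∑ b, q b ^ 2 = 1 ∧ M = quat q := by
  rw [mem_specialUnitaryGroup_iff, mem_unitaryGroup_iff, star_eq_conjTranspose] at hM
  obtain ⟨hM1, hM2⟩ := hM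
  have hadj : Mᴴ = M.adjugate := by
    have h1 : M.adjugate * M = 1 := by rw [adjugate_mul, hM2, one_smul]
    calc Mᴴ = (M.adjugate * M) * Mᴴ := by rw [h1, Matrix.one_mul]
      _ = _ := by rw [Matrix.mul_assoc, hM1, Matrix.mul_one]
  rw [adjugate_fin_two] at hadj
  have h00 : star (M 0 0) = M 1 1 := by simpa using congrFun (congrFun hadj 0) 0
  have h01 : star (M 0 1) = -M 1 0 := by simpa using congrFun (congrFun hadj 1) 0
  have hq : M = quat ![(M 0 0).re, (M 0 0).im, (M 0 1).re, (M 0 1).im] := by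
    ext i j
    fin_cases i <;> fin_cases j
    · simp [quat]
    · simp [quat]
    · have : M 1 0 = -star (M 0 1) := by rw [h01, neg_neg]
      simp [quat, Complex.ext_iff, this]
    · simp [quat, Complex.ext_iff, ← h00]
  refine ⟨_, ?_, hq⟩
  rw [hq, quat_mul_conjTranspose_self] at hM1
  have := congrFun (congrFun hM1 0) 0
  simp only [Matrix.smul_apply, one_apply_eq, smul_eq_mul, mul_one] at this
  exact_mod_cast this

theorem quat_add_smul (q p : Fin 4 → ℝ) (t : ℝ) : quat (q + t • p) = quat q + (t : ℂ) • quat p := by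
  ext i j
  fin_cases i <;> fin_cases j <;> simp [quat, Complex.ext_iff] <;> ring_nf

theorem quat_mul_conjTranspose_add (p q : Fin 4 → ℝ) :
    quat p * (quat q)ᴴ + quat q * (quat p)ᴴ = ((2 * ∑ b, p b * q b : ℝ) : ℂ) • 1 := by
  rw [quat_mul_conjTranspose, quat_mul_conjTranspose]
  ext i j
  fin_cases i <;> fin_cases j <;> simp [quat, Fin.sum_univ_four, Complex.ext_iff] <;>
    ring_nf <;> simp

theorem trace_quat_mul_conjTranspose (p q : Fin 4 → ℝ) :
    (quat p * (quat q)ᴴ).trace = ((2 * ∑ b, p b * q b : ℝ) : ℂ) := by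
  rw [quat_mul_conjTranspose, trace_fin_two]
  simp [quat, Fin.sum_univ_four]
  ring

theorem exists_quat_eq_smul_add_mul {p q : Fin 4 → ℝ} (hp : ∑ b, p b ^ 2 = 1)
    (hq : ∑ b, q b ^ 2 = 1) :
    ∃ Ω : Matrix (Fin 2) (Fin 2) ℂ, Ωᴴ = -Ω ∧ Ω.trace = 0 ∧ ‖Ω‖ ≤ 3 ∧
      quat p = (((∑ b, p b * q b : ℝ) : ℂ) • 1 + Ω) * quat q := by
  have hu := entrywise_sup_norm_bound_of_unitary
    (mul_mem (mem_specialUnitaryGroup_iff.1 (quat_mem_specialUnitaryGroup hp)).1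
      (Unitary.star_mem (mem_specialUnitaryGroup_iff.1 (quat_mem_specialUnitaryGroup hq)).1))
  rw [star_eq_conjTranspose] at hu
  have hw : |∑ b, p b * q b| ≤ 1 := by
    have h := Matrix.abs_re_trace_le (quat p * (quat q)ᴴ)
    rw [trace_quat_mul_conjTranspose, Complex.ofReal_re, abs_mul, abs_two] at h
    simp only [Fintype.card_fin, Nat.cast_ofNat] at h
    linarith
  have ha := quat_mul_conjTranspose_add p q
  have ht := trace_quat_mul_conjTranspose p q
  set w := ∑ b, p b * q b
  have h1 : ‖(1 : Matrix (Fin 2) (Fin 2) ℂ)‖ ≤ 1 :=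
    norm_le_one_of_mem_specialUnitaryGroup (one_mem _)
  refine ⟨quat p * (quat q)ᴴ - (w : ℂ) • 1, ?_, ?_, ?_, ?_⟩
  · rw [conjTranspose_sub, conjTranspose_mul, conjTranspose_conjTranspose, conjTranspose_smul,
      conjTranspose_one, Complex.star_def, Complex.conj_ofReal, eq_sub_of_add_eq' ha]
    push_cast
    module
  · rw [trace_sub, ht, trace_smul, trace_one]
    simp
    ring
  · refine (norm_sub_le _ _).trans ?_
    rw [norm_smul, Complex.norm_real, Real.norm_eq_abs]
    nlinarith [norm_nonneg (1 : Matrix (Fin 2) (Fin 2) ℂ), abs_nonneg w]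
  · rw [add_sub_cancel, Matrix.mul_assoc, ← star_eq_conjTranspose, mem_unitaryGroup_iff'.1
      (mem_specialUnitaryGroup_iff.1 (quat_mem_specialUnitaryGroup hq)).1, Matrix.mul_one]

end Quaternion

section Lojasiewicz

variable {n : ℕ}

/-- The Kronecker product of quaternion matrices with the given coordinates. -/
def quatKron (q : Fin n × Fin 4 → ℝ) : Matrix (Fin n → Fin 2) (Fin n → Fin 2) ℂ :=
  kron fun k => quat fun b => q (k, b)

theorem quatKron_update (q : Fin n × Fin 4 → ℝ) (k : Fin n) (b : Fin 4) (t : ℝ)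
    {M : Matrix (Fin 2) (Fin 2) ℂ} (hM : quat (Pi.single b 1) = M * quat fun b => q (k, b)) :
    quatKron (Function.update q (k, b) (q (k, b) + t)) =
      quatKron q + (t : ℂ) • (localOp n k M * quatKron q) := by
  have h : quatKron q + (t : ℂ) • (localOp n k M * quatKron q) =
      localOp n k (1 + (t : ℂ) • M) * quatKron q := by
    rw [localOp_add, localOp_smul, localOp_one, Matrix.add_mul, Matrix.one_mul, Matrix.smul_mul]
  rw [h, quatKron, quatKron, localOp_mul_kron]
  congr 1
  ext1 l
  by_cases hl : l = k
  · subst hl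
    rw [Function.update_self, Matrix.add_mul, Matrix.one_mul, Matrix.smul_mul, ← hM,
      ← quat_add_smul]
    congr 1
    ext b'
    by_cases hb : b' = b
    · subst hb; simp
    · simp [hb]
  · rw [Function.update_of_ne hl]
    congr 1
    ext b'
    rw [Function.update_of_ne (by simp [hl])]

theorem prod_sum_sq_update {q : Fin n × Fin 4 → ℝ} (hq : ∀ k, ∑ b, q (k, b) ^ 2 = 1)
    (k : Fin n) (b : Fin 4) (t : ℝ) :
    ∏ l, ∑ b', Function.update q (k, b) (q (k, b) + t) (l, b') ^ 2 =
      1 + 2 * q (k, b) * t + t ^ 2 := by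
  rw [Finset.prod_eq_single k]
  · have h1 := hq k
    rw [← Finset.add_sum_erase _ _ (Finset.mem_univ b)] at h1 ⊢
    rw [Function.update_self, Finset.sum_congr rfl fun b' hb' => by
      rw [Function.update_of_ne (by simp [Finset.ne_of_mem_erase hb'])]]
    linarith
  · intro l _ hl
    rw [← hq l]
    exact Finset.sum_congr rfl fun b' _ => by rw [Function.update_of_ne (by simp [hl])]
  · simp

theorem IsPolyFun.matrix_mul {σ m : Type*} [Fintype m] {F G : (σ → ℝ) → Matrix m m ℂ}
    (hF : ∀ i j, IsPolyFun fun q => F q i j) (hG : ∀ i j, IsPolyFun fun q => G q i j) (i j : m) :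
    IsPolyFun fun q => (F q * G q) i j := by
  simp only [mul_apply]
  exact IsPolyFun.sum fun k _ => (hF i k).mul (hG k j)

theorem isPolyFun_quatKron (i j : Fin n → Fin 2) :
    IsPolyFun fun q : Fin n × Fin 4 → ℝ => quatKron q i j := by
  simp only [quatKron, kron, of_apply]
  refine IsPolyFun.prod fun k _ => ?_
  have h : ∀ b, IsPolyFun fun q : Fin n × Fin 4 → ℝ => (q (k, b) : ℂ) := fun b =>
    IsPolyFun.coord (k, b)
  generalize i k = i'
  generalize j k = j'
  fin_cases i' <;> fin_cases j'
  · exact (h 0).add ((h 1).mul (.const _))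
  · exact (h 2).add ((h 3).mul (.const _))
  · exact (h 2).neg.add ((h 3).mul (.const _))
  · exact (h 0).sub ((h 1).mul (.const _))

theorem isPolyFun_overlap_quatKron (A C : Matrix (Fin n → Fin 2) (Fin n → Fin 2) ℂ) :
    IsPolyFun fun q : Fin n × Fin 4 → ℝ => (overlap A C (quatKron q) : ℂ) := by
  refine IsPolyFun.re ?_
  simp only [trace, diag_apply]
  refine IsPolyFun.sum fun i _ => ?_
  have h1 := IsPolyFun.matrix_mul (G := fun _ => A) isPolyFun_quatKron fun i j => .const (A i j)
  have h2 := IsPolyFun.matrix_mul (G := fun q => (quatKron q)ᴴ) h1 fun i j =>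
    (isPolyFun_quatKron j i).star
  exact IsPolyFun.matrix_mul (F := fun _ => Cᴴ) (fun i j => .const (Cᴴ i j)) h2 i i

/-- A Łojasiewicz inequality for the objective function on the group of local unitaries. -/
theorem IsSuLocProj.exists_lojasiewicz {P : Matrix (Fin n → Fin 2) (Fin n → Fin 2) ℂ →
    Matrix (Fin n → Fin 2) (Fin n → Fin 2) ℂ} (hP : IsSuLocProj P)
    (A C : Matrix (Fin n → Fin 2) (Fin n → Fin 2) ℂ) (c : ℝ) :
    ∃ (M C₁ : ℝ) (N : ℕ), 0 ≤ M ∧ 0 ≤ C₁ ∧ ∀ V ∈ SUloc n, overlap A C V ≠ c →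
      1 ≤ M * |overlap A C V - c| *
        (3 + C₁ * ‖P (overlapGrad A C V)‖ / |overlap A C V - c|) ^ N := by
  let Φ : (Fin n × Fin 4 → ℝ) → ℝ := fun q =>
    overlap A C (quatKron q) - c * ∏ k, ∑ b, q (k, b) ^ 2
  have hΦ : IsPolyFun fun q => (Φ q : ℂ) := by
    simp only [Φ, Complex.ofReal_sub, Complex.ofReal_mul, Complex.ofReal_prod, Complex.ofReal_sum,
      pow_two]
    exact (isPolyFun_overlap_quatKron A C).sub ((IsPolyFun.const _).mul (IsPolyFun.prod fun k _ =>
      IsPolyFun.sum fun b _ => (IsPolyFun.coord (k, b)).mul (IsPolyFun.coord (k, b))))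
  obtain ⟨M, N, hM, h⟩ := hΦ.exists_one_le_mul_abs_mul_pow le_rfl
  refine ⟨M, (Fintype.card (Fin n → Fin 2)) ^ 2 * 3, N, hM, by positivity, fun V hV hVc => ?_⟩
  obtain ⟨K, hK, rfl⟩ := mem_SUloc_iff.1 hV
  choose q hq hKq using fun k => exists_quat_eq (hK k)
  obtain rfl : K = fun k => quat (q k) := funext hKq
  let p : Fin n × Fin 4 → ℝ := fun x => q x.1 x.2
  have hp : ∀ k, ∑ b, p (k, b) ^ 2 = 1 := hq
  have hVp : kron (fun k => quat (q k)) = quatKron p := rfl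
  rw [hVp] at hVc ⊢
  have hΦp : Φ p = overlap A C (quatKron p) - c := by
    simp [Φ, hp]
  have hp1 : ∀ i, |p i| ≤ 1 := by
    rintro ⟨k, b⟩
    rw [← sq_le_one_iff_abs_le_one, ← hp k]
    exact Finset.single_le_sum (f := fun b => p (k, b) ^ 2) (fun _ _ => sq_nonneg _)
      (Finset.mem_univ b)
  set G := overlapGrad A C (quatKron p) with hG
  set y := |overlap A C (quatKron p) - c| with hy
  have hy0 : 0 < y := abs_pos.2 (sub_ne_zero.2 hVc)
  have key := h p (2 * y + (Fintype.card (Fin n → Fin 2)) ^ 2 * 3 * ‖P G‖) hp1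
    (by rw [hΦp]; exact sub_ne_zero.2 hVc) (by positivity) ?_
  · rw [hΦp, ← hy] at key
    convert key using 3
    field_simp
    ring
  rintro ⟨k, b⟩
  obtain ⟨Ω, hΩ, hΩt, hΩn, hΩq⟩ := exists_quat_eq_smul_add_mul
    (p := Pi.single b 1) (q := fun b => p (k, b)) (by simp [Pi.single_apply]) (hp k)
  have hw : ∑ b', (Pi.single b 1 : Fin 4 → ℝ) b' * p (k, b') = p (k, b) := by
    simp [Pi.single_apply]
  rw [hw] at hΩq
  have hmem := localOp_mem_suLoc k hΩ hΩt
  have hV' : HasDerivAt (fun t : ℝ => quatKron (Function.update p (k, b) (p (k, b) + t)))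
      (((p (k, b) : ℂ) • 1 + localOp n k Ω) *
        quatKron (Function.update p (k, b) (p (k, b) + 0))) 0 := by
    simp only [quatKron_update p k b _ hΩq]
    have h1 := (((hasDerivAt_id (0 : ℝ)).ofReal_comp).smul_const
      (localOp n k (((p (k, b) : ℝ) : ℂ) • 1 + Ω) * quatKron p)).const_add (quatKron p)
    refine h1.congr_deriv ?_
    rw [Complex.ofReal_one, one_smul, localOp_add, localOp_smul, localOp_one, Complex.ofReal_zero,
      zero_smul, add_zero]
  have hF := hV'.overlap (A := A) (C := C) (conjTranspose_of_mem_suLoc hmem)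
  rw [add_zero, Function.update_eq_self, ← hG, ← hP.re_trace_conjTranspose_mul hmem] at hF
  have hN : HasDerivAt (fun t : ℝ => ∏ l, ∑ b', Function.update p (k, b) (p (k, b) + t) (l, b') ^ 2)
      (2 * p (k, b)) 0 := by
    simp only [prod_sum_sq_update hp]
    have h1 := (((hasDerivAt_id (0 : ℝ)).const_mul (2 * p (k, b))).const_add 1).add
      ((hasDerivAt_id (0 : ℝ)).pow 2)
    exact h1.congr_deriv (by simp)
  refine ⟨_, hF.sub (hN.const_mul c), ?_⟩
  have h1 : |2 * p (k, b) * (overlap A C (quatKron p) - c)| ≤ 2 * y := by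
    rw [abs_mul, abs_mul, abs_two, ← hy]
    nlinarith [hp1 (k, b)]
  have h2 := abs_re_trace_conjTranspose_mul_le (localOp n k Ω) (P G)
  have h3 := (norm_localOp_le k Ω).trans hΩn
  have h4 : (Fintype.card (Fin n → Fin 2) : ℝ) ^ 2 * (‖localOp n k Ω‖ * ‖P G‖) ≤
      (Fintype.card (Fin n → Fin 2)) ^ 2 * 3 * ‖P G‖ := by
    rw [mul_assoc]
    gcongr
  calc _ = |2 * p (k, b) * (overlap A C (quatKron p) - c) +
        ((localOp n k Ω)ᴴ * P G).trace.re| := by congr 1; ring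
    _ ≤ _ := abs_add_le _ _
    _ ≤ _ := add_le_add h1 (h2.trans h4)

end Lojasiewicz

section Invariance

theorem exists_path_specialUnitaryGroup {Ω : Matrix (Fin 2) (Fin 2) ℂ} (hΩ : Ωᴴ = -Ω)
    (hΩt : Ω.trace = 0) :
    ∃ K : ℝ → Matrix (Fin 2) (Fin 2) ℂ, (∀ h, K h ∈ Matrix.specialUnitaryGroup (Fin 2) ℂ) ∧
      K 0 = 1 ∧ HasDerivAt K Ω 0 := by
  obtain ⟨p, hp0, hp⟩ : ∃ p : Fin 4 → ℝ, p 0 = 0 ∧ Ω = quat p := by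
    refine ⟨![0, (Ω 0 0).im, (Ω 0 1).re, (Ω 0 1).im], rfl, ?_⟩
    have h00 : star (Ω 0 0) = -Ω 0 0 := congrFun (congrFun hΩ 0) 0
    have h01 : star (Ω 0 1) = -Ω 1 0 := congrFun (congrFun hΩ 1) 0
    have h11 : Ω 1 1 = -Ω 0 0 := by
      rw [trace_fin_two] at hΩt
      exact eq_neg_of_add_eq_zero_right hΩt
    have h10 : Ω 1 0 = -star (Ω 0 1) := by rw [h01, neg_neg]
    have hre : (Ω 0 0).re = 0 := by
      have := congrArg Complex.re h00
      simp at this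
      linarith
    ext i j
    fin_cases i <;> fin_cases j <;> simp [quat, Complex.ext_iff, h11, h10, hre]
  have hone : quat (Pi.single 0 1) = 1 := by
    ext i j
    fin_cases i <;> fin_cases j <;> simp [quat]
  set s := ∑ b, p b ^ 2 with hs
  have hs0 : 0 ≤ s := Finset.sum_nonneg fun _ _ => sq_nonneg _
  have hpos : ∀ h : ℝ, 0 < 1 + h ^ 2 * s := fun h => by positivity
  refine ⟨fun h => quat ((√(1 + h ^ 2 * s))⁻¹ • (Pi.single 0 1 + h • p)), fun h => ?_, ?_, ?_⟩
  · refine quat_mem_specialUnitaryGroup ?_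
    have h1 : ∑ b, ((√(1 + h ^ 2 * s))⁻¹ • (Pi.single 0 1 + h • p) : Fin 4 → ℝ) b ^ 2 =
        (√(1 + h ^ 2 * s))⁻¹ ^ 2 * (1 + h ^ 2 * s) := by
      rw [hs]
      simp only [Fin.sum_univ_four, Pi.smul_apply, Pi.add_apply, smul_eq_mul, hp0]
      simp
      ring
    rw [h1, inv_pow, Real.sq_sqrt (hpos h).le, inv_mul_cancel₀ (hpos h).ne']
  · simpa using hone
  · have hφ : HasDerivAt (fun h : ℝ => (√(1 + h ^ 2 * s))⁻¹) 0 0 := by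
      have h1 : HasDerivAt (fun h : ℝ => 1 + h ^ 2 * s) 0 0 := by
        simpa using (((hasDerivAt_id (0 : ℝ)).pow 2).mul_const s).const_add 1
      exact ((h1.sqrt (by simp)).fun_inv (by simp)).congr_deriv (by simp)
    have hq : ∀ h : ℝ, quat ((√(1 + h ^ 2 * s))⁻¹ • (Pi.single 0 1 + h • p)) =
        (√(1 + h ^ 2 * s))⁻¹ • (1 + h • Ω) := by
      intro h
      have h0 : quat 0 = 0 := by
        ext i j
        fin_cases i <;> fin_cases j <;> simp [quat]
      have h1 := quat_add_smul 0 (Pi.single 0 1 + h • p) (√(1 + h ^ 2 * s))⁻¹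
      rw [zero_add, h0, zero_add, quat_add_smul, hone, ← hp] at h1
      rw [h1, Complex.coe_smul, Complex.coe_smul]
    simp only [hq]
    have h2 : HasDerivAt (fun h : ℝ => (1 : Matrix (Fin 2) (Fin 2) ℂ) + h • Ω) Ω 0 := by
      exact (((hasDerivAt_id (0 : ℝ)).smul_const Ω).const_add 1).congr_deriv (one_smul ℝ Ω)
    exact (hφ.fun_smul h2).congr_deriv (by simp)

variable {n : ℕ}

theorem hasDerivAt_kron {K : ℝ → Fin n → Matrix (Fin 2) (Fin 2) ℂ}
    {Ω : Fin n → Matrix (Fin 2) (Fin 2) ℂ} (h0 : ∀ k, K 0 k = 1)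
    (h : ∀ k, HasDerivAt (fun t => K t k) (Ω k) 0) :
    HasDerivAt (fun t => kron (K t)) (∑ k, localOp n k (Ω k)) 0 := by
  refine hasDerivAt_pi.2 fun i => hasDerivAt_pi.2 fun j => ?_
  have h1 := HasDerivAt.fun_finsetProd (u := Finset.univ) (x := (0 : ℝ))
    (f := fun k t => K t k (i k) (j k)) fun k _ =>
      hasDerivAt_pi.1 (hasDerivAt_pi.1 (h k) (i k)) (j k)
  refine h1.congr_deriv ?_
  rw [Matrix.sum_apply]
  refine Finset.sum_congr rfl fun k _ => ?_
  simp only [h0, localOp, of_apply, one_apply, smul_eq_mul]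
  rw [mul_comm]

theorem exists_path_SUloc {g : Matrix (Fin n → Fin 2) (Fin n → Fin 2) ℂ} (hg : g ∈ suLoc n) :
    ∃ γ : ℝ → Matrix (Fin n → Fin 2) (Fin n → Fin 2) ℂ, (∀ h, γ h ∈ SUloc n) ∧ γ 0 = 1 ∧
      HasDerivAt γ g 0 := by
  obtain ⟨Ω, hΩ, rfl⟩ := hg
  choose K hK hK0 hK' using fun k => exists_path_specialUnitaryGroup (hΩ k).1 (hΩ k).2
  exact ⟨fun h => kron fun k => K k h, fun h => mem_SUloc_iff.2 ⟨_, fun k => hK k h, rfl⟩,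
    by simp only [hK0, kron_one], hasDerivAt_kron hK0 hK'⟩

/-- A linear flow generated by local Hamiltonians stays in the group of local unitaries. -/
theorem mem_SUloc_of_hasDerivAt {U Ω : ℝ → Matrix (Fin n → Fin 2) (Fin n → Fin 2) ℂ} {T B : ℝ}
    (hT : 0 ≤ T) (hΩ : ∀ t ∈ Set.Icc 0 T, Ω t ∈ suLoc n) (hB : ∀ t ∈ Set.Icc 0 T, ‖Ω t‖ ≤ B)
    (hU : ∀ t ∈ Set.Icc 0 T, HasDerivAt U (Ω t * U t) t) (hU0 : U 0 ∈ SUloc n) :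
    U T ∈ SUloc n := by
  have hc := isCompact_SUloc n
  have hne := SUloc_nonempty n
  rw [hc.isClosed.mem_iff_infDist_zero hne]
  refine le_antisymm ?_ Metric.infDist_nonneg
  have key := le_gronwallBound_of_liminf_deriv_right_le (a := 0) (b := T) (δ := 0)
    (f := fun t => Metric.infDist (U t) (SUloc n)) (K := Fintype.card (Fin n → Fin 2) * B) (ε := 0)
    (f' := fun t => Fintype.card (Fin n → Fin 2) * B * Metric.infDist (U t) (SUloc n)) ?_ ?_
    (Metric.infDist_zero_of_mem hU0).le (fun _ _ => by simp) T ⟨hT, le_rfl⟩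
  · simpa [gronwallBound_ε0] using key
  · exact fun t ht => ((Metric.continuous_infDist_pt _).continuousAt.comp
      (hU t ht).continuousAt).continuousWithinAt
  · intro x hx r hr
    have hx' : x ∈ Set.Icc 0 T := ⟨hx.1, hx.2.le⟩
    obtain ⟨V, hV, hVd⟩ := hc.exists_infDist_eq_dist hne (U x)
    obtain ⟨γ, hγ, hγ0, hγ'⟩ := exists_path_SUloc (hΩ x hx')
    have h1 : HasDerivAt (fun z => γ (z - x)) (Ω x) x := by
      refine HasDerivAt.comp_sub_const x x ?_
      rwa [sub_self]
    have h2 := (hU x hx').sub (h1.matrix_mul (hasDerivAt_const x V))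
    have h3 : ‖Ω x * U x - (Ω x * V + γ (x - x) * 0)‖ < r := by
      refine lt_of_le_of_lt ?_ hr
      rw [Matrix.mul_zero, add_zero, ← Matrix.mul_sub, hVd, dist_eq_norm, mul_assoc]
      refine (norm_mul_le_card_mul _ _).trans ?_
      gcongr
      exact hB x hx'
    refine (h2.hasDerivWithinAt.liminf_right_slope_norm_le h3).mp ?_
    filter_upwards [self_mem_nhdsWithin] with z hz h4
    refine lt_of_le_of_lt ?_ h4
    have hzx : 0 ≤ (z - x)⁻¹ := inv_nonneg.2 (sub_nonneg.2 (le_of_lt hz))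
    refine mul_le_mul_of_nonneg_left (sub_le_sub ?_ ?_) hzx
    · rw [Pi.sub_apply, ← dist_eq_norm]
      exact Metric.infDist_le_dist_of_mem (mul_mem_SUloc (hγ _) hV)
    · rw [Pi.sub_apply, sub_self, hγ0, Matrix.one_mul, ← dist_eq_norm, hVd]

end Invariance

theorem eq_zero_of_tendsto_of_hasDerivAt {f d : ℝ → ℝ} {c L : ℝ}
    (hf : ∀ t, 0 ≤ t → HasDerivAt f (d t) t) (hfc : Tendsto f atTop (𝓝 c))
    (hd : Tendsto d atTop (𝓝 L)) : L = 0 := by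
  have h : ∀ t, ∃ ξ, t ≤ ξ ∧ (0 ≤ t → d ξ = f (t + 1) - f t) := by
    intro t
    by_cases ht : 0 ≤ t
    · obtain ⟨ξ, hξ, hξd⟩ := exists_hasDerivAt_eq_slope f d (lt_add_one t)
        (fun s hs => (hf s (ht.trans hs.1)).continuousAt.continuousWithinAt)
        fun s hs => hf s (ht.trans hs.1.le)
      exact ⟨ξ, hξ.1.le, fun _ => by simpa using hξd⟩
    · exact ⟨t, le_rfl, fun h => absurd h ht⟩
  choose ξ hξ hξd using h
  have h1 : Tendsto (fun t => d (ξ t)) atTop (𝓝 L) :=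
    hd.comp (tendsto_atTop_mono hξ tendsto_id)
  have h2 : Tendsto (fun t => f (t + 1) - f t) atTop (𝓝 (c - c)) :=
    (hfc.comp (tendsto_atTop_add_const_right _ 1 tendsto_id)).sub hfc
  rw [sub_self] at h2
  refine tendsto_nhds_unique (h1.congr' ?_) h2
  filter_upwards [eventually_ge_atTop 0] with t ht using hξd t ht

section Flow

variable {n : ℕ} {P : Matrix (Fin n → Fin 2) (Fin n → Fin 2) ℂ →
    Matrix (Fin n → Fin 2) (Fin n → Fin 2) ℂ} {A C : Matrix (Fin n → Fin 2) (Fin n → Fin 2) ℂ}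
  {U : ℝ → Matrix (Fin n → Fin 2) (Fin n → Fin 2) ℂ}

namespace IsSuLocProj

theorem flow_mem_SUloc (hP : IsSuLocProj P)
    (hode : ∀ t, 0 ≤ t → HasDerivAt U (P (overlapGrad A C (U t)) * U t) t) (hU0 : U 0 ∈ SUloc n)
    {t : ℝ} (ht : 0 ≤ t) : U t ∈ SUloc n := by
  have hcont : ContinuousOn (fun s => P (overlapGrad A C (U s))) (Set.Icc 0 t) := fun s hs =>
    ((hP.continuous.comp (continuous_overlapGrad A C)).continuousAt.comp
      (hode s hs.1).continuousAt).continuousWithinAt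
  obtain ⟨B, hB⟩ := isCompact_Icc.exists_bound_of_continuousOn hcont
  exact mem_SUloc_of_hasDerivAt ht (fun s _ => hP.mem _) hB (fun s hs => hode s hs.1) hU0

theorem hasDerivAt_overlap (hP : IsSuLocProj P) {t : ℝ}
    (hode : HasDerivAt U (P (overlapGrad A C (U t)) * U t) t) :
    HasDerivAt (fun s => overlap A C (U s))
      ((P (overlapGrad A C (U t)))ᴴ * P (overlapGrad A C (U t))).trace.re t := by
  have h := HasDerivAt.overlap (A := A) (C := C) (w := 0) (V := U)
    (Ω := P (overlapGrad A C (U t))) (by simpa using hode)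
    (conjTranspose_of_mem_suLoc (hP.mem _))
  rw [← hP.re_trace_conjTranspose_mul (hP.mem _)] at h
  simpa using h

theorem monotoneOn_overlap (hP : IsSuLocProj P)
    (hode : ∀ t, 0 ≤ t → HasDerivAt U (P (overlapGrad A C (U t)) * U t) t) :
    MonotoneOn (fun t => overlap A C (U t)) (Set.Ici 0) := by
  refine monotoneOn_of_deriv_nonneg (convex_Ici 0)
    (fun t ht => (hP.hasDerivAt_overlap (hode t ht)).continuousAt.continuousWithinAt)
    (fun t ht => (hP.hasDerivAt_overlap (hode t
      (interior_subset ht))).differentiableAt.differentiableWithinAt) fun t ht => ?_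
  rw [(hP.hasDerivAt_overlap (hode t (interior_subset ht))).deriv]
  exact (sq_nonneg _).trans (norm_sq_le_re_trace _)

theorem exists_tendsto_overlap (hP : IsSuLocProj P)
    (hode : ∀ t, 0 ≤ t → HasDerivAt U (P (overlapGrad A C (U t)) * U t) t) (hU0 : U 0 ∈ SUloc n) :
    ∃ c, Tendsto (fun t => overlap A C (U t)) atTop (𝓝 c) ∧
      ∀ t, 0 ≤ t → overlap A C (U t) ≤ c := by
  obtain ⟨B, hB⟩ := ((isCompact_SUloc n).image (continuous_overlap A C)).bddAbove
  have hmono : Monotone fun t => overlap A C (U (max t 0)) := fun s t hst =>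
    hP.monotoneOn_overlap hode (le_max_right s 0) (le_max_right t 0) (max_le_max_right 0 hst)
  have hbdd : BddAbove (Set.range fun t => overlap A C (U (max t 0))) := by
    refine ⟨B, ?_⟩
    rintro _ ⟨t, rfl⟩
    exact hB ⟨_, hP.flow_mem_SUloc hode hU0 (le_max_right t 0), rfl⟩
  refine ⟨_, (tendsto_atTop_ciSup hmono hbdd).congr' ?_, fun t ht => ?_⟩
  · filter_upwards [eventually_ge_atTop 0] with t ht
    rw [max_eq_left ht]
  · simpa [ht] using le_ciSup hbdd t

theorem exists_tendsto_flow (hP : IsSuLocProj P)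
    (hode : ∀ t, 0 ≤ t → HasDerivAt U (P (overlapGrad A C (U t)) * U t) t) (hU0 : U 0 ∈ SUloc n) :
    ∃ V ∈ SUloc n, Tendsto U atTop (𝓝 V) ∧ P (overlapGrad A C V) = 0 := by
  have hmem : ∀ t, 0 ≤ t → U t ∈ SUloc n := fun t ht => hP.flow_mem_SUloc hode hU0 ht
  obtain ⟨c, hc, hle⟩ := hP.exists_tendsto_overlap hode hU0
  obtain ⟨M, C₁, N, hM, hC₁, hL⟩ := hP.exists_lojasiewicz A C c
  obtain ⟨V, hV⟩ := exists_tendsto_of_lojasiewicz (u := U) (M := M) (N := N)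
    (C₂ := Fintype.card (Fin n → Fin 2)) (y := fun t => c - overlap A C (U t))
    (ρ := fun t => ‖P (overlapGrad A C (U t))‖) hC₁ (by positivity) hM hode
    (fun t ht => (hP.hasDerivAt_overlap (hode t ht)).const_sub c) (fun _ _ => norm_nonneg _)
    (fun t _ => norm_sq_le_re_trace _)
    (fun t ht => (norm_mul_le_card_mul _ _).trans (by
      gcongr
      exact mul_le_of_le_one_right (norm_nonneg _) (norm_le_one_of_mem_SUloc (hmem t ht))))
    (fun t ht => sub_nonneg.2 (hle t ht)) (by simpa using hc.const_sub c) fun t ht hy => by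
      have h := hL (U t) (hmem t ht) (sub_pos.1 hy).ne
      rwa [abs_sub_comm, abs_of_pos hy] at h
  refine ⟨V, (isCompact_SUloc n).isClosed.mem_of_tendsto hV
    ((eventually_ge_atTop 0).mono hmem), hV, ?_⟩
  have hcont : Continuous fun V => ((P (overlapGrad A C V))ᴴ * P (overlapGrad A C V)).trace.re := by
    have h := hP.continuous.comp (continuous_overlapGrad A C)
    exact Complex.continuous_re.comp (h.matrix_conjTranspose.matrix_mul h).matrix_trace
  have h0 := eq_zero_of_tendsto_of_hasDerivAt (fun t ht => hP.hasDerivAt_overlap (hode t ht)) hc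
    ((hcont.tendsto V).comp hV)
  have h1 := norm_sq_le_re_trace (P (overlapGrad A C V))
  rw [h0] at h1
  exact norm_eq_zero.1 (pow_eq_zero_iff two_ne_zero |>.1 (le_antisymm h1 (sq_nonneg _)))

end IsSuLocProj

end Flow

/-- Any solution of the gradient system `U' = P([C†, U A U†])·U` (with `P` the orthogonal
projection onto `su_loc(2^n)` w.r.t. `⟨g,h⟩ = Re tr(g†h)`) starting in `SU_loc(2^n)` stays
in `SU_loc(2^n)`, increases `t ↦ Re tr(C† U A U†)` monotonically, and converges as `t → ∞`
to some `U∞ ∈ SU_loc(2^n)` satisfying the critical point condition `P([C†, U∞AU∞†]) = 0`. -/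
theorem stmt18 (n : ℕ) (hn : 1 ≤ n)
    (A C : Matrix (Fin n → Fin 2) (Fin n → Fin 2) ℂ)
    (P : Matrix (Fin n → Fin 2) (Fin n → Fin 2) ℂ →
      Matrix (Fin n → Fin 2) (Fin n → Fin 2) ℂ)
    (hP1 : ∀ g, P g ∈ suLoc n)
    (hP2 : ∀ g ∈ suLoc n, P g = g)
    (hP3 : ∀ g, ∀ h ∈ suLoc n, (((g - P g)ᴴ * h).trace).re = 0)
    (U : ℝ → Matrix (Fin n → Fin 2) (Fin n → Fin 2) ℂ)
    (hU0 : U 0 ∈ SUloc n)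
    (hode : ∀ t : ℝ, 0 ≤ t →
      HasDerivAt U
        (P (Cᴴ * (U t * A * (U t)ᴴ) - (U t * A * (U t)ᴴ) * Cᴴ) * U t) t) :
    (∀ t : ℝ, 0 ≤ t → U t ∈ SUloc n) ∧
    MonotoneOn (fun t : ℝ => ((Cᴴ * (U t * A * (U t)ᴴ)).trace).re) (Set.Ici (0 : ℝ)) ∧
    ∃ Ulim ∈ SUloc n,
      Tendsto U atTop (𝓝 Ulim) ∧
      P (Cᴴ * (Ulim * A * Ulimᴴ) - (Ulim * A * Ulimᴴ) * Cᴴ) = 0 := by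
  have hP : IsSuLocProj P := ⟨hP1, hP3⟩
  exact ⟨fun t ht => hP.flow_mem_SUloc hode hU0 ht, hP.monotoneOn_overlap hode,
    hP.exists_tendsto_flow hode hU0⟩
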